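/- arXiv:2305.02566 — 2 statements merged into one kernel-verified Lean document; each statement's English description precedes it below -/
import Mathlib

section
/- Let h ∈ ℝ[x₁,…,x_m] be a polynomial, homogeneous of degree d, that is hyperbolic with respect to a direction e lying in its open hyperbolicity cone Γ₊₊. Let ξ₁,…,ξₙ be independent real random variables, each with finite support, with E[ξᵢ] = μᵢ and Var[ξᵢ] = τᵢ². Let v₁,…,vₙ be vectors in the closed hyperbolicity cone Γ₊ with rank_h(vᵢ) ≤ 1 for every i ∈ [n], and set σ² = ‖Σ_{i=1}^n τᵢ² tr_h[vᵢ] vᵢ‖_h. Then there exists an assignment (s₁,…,sₙ), with each sᵢ in the support of ξᵢ, such that ‖Σ_{i=1}^n (sᵢ − μᵢ) vᵢ‖_h ≤ 4σ. -/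
open MvPolynomial Finset
open scoped Classical

noncomputable section

/-- `h` is homogeneous of degree `d`, positive at `e`, and for every `x` the univariate
polynomial `t ↦ h (t • e - x)` factors with real roots `lam x 1 ≥ … ≥ lam x d`
(the hyperbolic eigenvalues of `x`). -/
def IsHyperbolic {m d : ℕ} (h : MvPolynomial (Fin m) ℝ) (e : Fin m → ℝ)
    (lam : (Fin m → ℝ) → Fin d → ℝ) : Prop :=
  h.IsHomogeneous d ∧ 0 < eval e h ∧ (∀ x, Antitone (lam x)) ∧
    ∀ x : Fin m → ℝ, ∀ t : ℝ,
      eval (t • e - x) h = eval e h * ∏ i, (t - lam x i)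

/-- hyperbolic trace: the sum of the hyperbolic eigenvalues. -/
def htrace {m d : ℕ} (lam : (Fin m → ℝ) → Fin d → ℝ) (x : Fin m → ℝ) : ℝ :=
  ∑ i, lam x i

/-- hyperbolic rank: the number of nonzero hyperbolic eigenvalues. -/
def hrank {m d : ℕ} (lam : (Fin m → ℝ) → Fin d → ℝ) (x : Fin m → ℝ) : ℕ :=
  Nat.card {i : Fin d // lam x i ≠ 0}

/-- hyperbolic norm: the largest absolute value of a hyperbolic eigenvalue. -/
def hnorm {m d : ℕ} (lam : (Fin m → ℝ) → Fin d → ℝ) (x : Fin m → ℝ) : ℝ :=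
  ⨆ i, |lam x i|

/-- closed hyperbolicity cone: all hyperbolic eigenvalues nonnegative. -/
def InCone {m d : ℕ} (lam : (Fin m → ℝ) → Fin d → ℝ) (x : Fin m → ℝ) : Prop :=
  ∀ i, 0 ≤ lam x i

/-- open hyperbolicity cone: all hyperbolic eigenvalues positive. -/
def InOpenCone {m d : ℕ} (lam : (Fin m → ℝ) → Fin d → ℝ) (x : Fin m → ℝ) : Prop :=
  ∀ i, 0 < lam x i

/-! ### Zeros of univariate polynomials in the upper half-plane -/

/-- The modulus of a polynomial without zeros in the closed upper half-plane increases along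
upward vertical rays. -/
lemma norm_eval_le_of_upper_zero_free (p : Polynomial ℂ)
    (hp : ∀ s : ℂ, 0 ≤ s.im → p.eval s ≠ 0) (s : ℂ) (hs : 0 ≤ s.im) (η : ℝ) (hη : 0 ≤ η) :
    ‖p.eval s‖ ≤ ‖p.eval (s + η * Complex.I)‖ := by
  have hr : ∀ ρ ∈ p.roots, ρ.im < 0 := by
    intro ρ hρ
    by_contra hc
    exact hp ρ (not_lt.mp hc) (Polynomial.isRoot_of_mem_roots hρ)
  have key : ∀ m : Multiset ℂ, (∀ ρ ∈ m, ρ.im < 0) →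
      ‖(m.map (fun ρ => s - ρ)).prod‖ ≤ ‖(m.map (fun ρ => s + η * Complex.I - ρ)).prod‖ := by
    intro m
    induction m using Multiset.induction with
    | empty => simp
    | cons a m ih =>
      intro hm
      simp only [Multiset.map_cons, Multiset.prod_cons, norm_mul]
      have ha := hm a (Multiset.mem_cons_self a m)
      refine mul_le_mul ?_ (ih fun ρ h => hm ρ (Multiset.mem_cons_of_mem h)) (norm_nonneg _)
        (norm_nonneg _)
      rw [Complex.norm_def, Complex.norm_def]
      apply Real.sqrt_le_sqrt
      simp only [Complex.normSq_apply, Complex.sub_re, Complex.sub_im, Complex.add_re,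
        Complex.add_im, Complex.mul_re, Complex.mul_im, Complex.I_re, Complex.I_im,
        Complex.ofReal_re, Complex.ofReal_im]
      nlinarith
  rw [(IsAlgClosed.splits p).eval_eq_prod_roots, (IsAlgClosed.splits p).eval_eq_prod_roots,
    norm_mul, norm_mul]
  exact mul_le_mul_of_nonneg_left (key _ hr) (norm_nonneg _)

/-- Continuity of zeros: a family of polynomial functions with bounded zeros, none of them real,
keeps its zeros out of the closed upper half-plane. -/
lemma upper_zero_free_of_path (F : ℝ → ℂ → ℂ) (hF : Continuous fun z : ℝ × ℂ => F z.1 z.2)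
    (hpoly : ∀ r, ∃ p : Polynomial ℂ, ∀ s, F r s = p.eval s)
    (R : ℝ) (hR : ∀ r ∈ Set.Icc (0 : ℝ) 1, ∀ s, F r s = 0 → ‖s‖ ≤ R)
    (hreal : ∀ r ∈ Set.Icc (0 : ℝ) 1, ∀ x : ℝ, F r x ≠ 0)
    (h0 : ∀ s : ℂ, 0 ≤ s.im → F 0 s ≠ 0) :
    ∀ s : ℂ, 0 ≤ s.im → F 1 s ≠ 0 := by
  set bad : Set ℝ := Prod.fst '' ((Set.Icc (0 : ℝ) 1 ×ˢ Metric.closedBall (0 : ℂ) R) ∩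
    {z | 0 ≤ z.2.im ∧ F z.1 z.2 = 0}) with hbad
  set good : Set ℝ :=
    {r | ∀ s : ℂ, 0 ≤ s.im → ∀ η : ℝ, 0 ≤ η → ‖F r s‖ ≤ ‖F r (s + η * Complex.I)‖} with hgood
  have hbadc : IsClosed bad := by
    refine IsCompact.isClosed (IsCompact.image (IsCompact.inter_right
      (isCompact_Icc.prod (isCompact_closedBall _ _)) ?_) continuous_fst)
    exact (isClosed_le continuous_const (Complex.continuous_im.comp continuous_snd)).inter
      (isClosed_eq hF continuous_const)
  have hgoodc : IsClosed good := by
    simp only [hgood, Set.ofPred_forall]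
    refine isClosed_iInter fun s => isClosed_iInter fun _ => isClosed_iInter fun η =>
      isClosed_iInter fun _ => isClosed_le ?_ ?_
    · exact (hF.comp (Continuous.prodMk_left s)).norm
    · exact (hF.comp (Continuous.prodMk_left (s + η * Complex.I))).norm
  have hmem : ∀ r ∈ Set.Icc (0 : ℝ) 1, (∀ s : ℂ, 0 ≤ s.im → F r s ≠ 0) → r ∈ good := by
    intro r _ hz s hs η hη
    obtain ⟨p, hp⟩ := hpoly r
    rw [hp, hp]
    exact norm_eval_le_of_upper_zero_free p (fun s hs => hp s ▸ hz s hs) s hs η hη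
  have hbadmem : ∀ r ∈ Set.Icc (0 : ℝ) 1, ∀ s : ℂ, 0 ≤ s.im → F r s = 0 → r ∈ bad := by
    intro r hr s hs hz
    exact ⟨(r, s), ⟨⟨hr, by simpa using hR r hr s hz⟩, hs, hz⟩, rfl⟩
  have hcover : Set.Icc (0 : ℝ) 1 ⊆ good ∪ bad := by
    intro r hr
    by_cases h : ∀ s : ℂ, 0 ≤ s.im → F r s ≠ 0
    · exact Or.inl (hmem r hr h)
    · push Not at h
      obtain ⟨s, hs, hz⟩ := h
      exact Or.inr (hbadmem r hr s hs hz)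
  intro s hs hz
  obtain ⟨r, hr, hrg, hrb⟩ := isPreconnected_closed_iff.mp isPreconnected_Icc good bad hgoodc hbadc
    hcover ⟨0, by simp, hmem 0 (by simp) h0⟩ ⟨1, by simp, hbadmem 1 (by simp) s hs hz⟩
  obtain ⟨⟨r', w⟩, ⟨_, hw, hz'⟩, rfl⟩ := hrb
  have := hrg (w.re : ℂ) (by simp) w.im hw
  rw [Complex.re_add_im, hz', norm_zero] at this
  exact hreal r' hr w.re (norm_le_zero_iff.mp this)

/-- A polynomial function on `ℂ` vanishing at all large reals vanishes. -/
lemma eq_zero_of_eventually_real (g : ℂ → ℂ) (hg : ∃ p : Polynomial ℂ, ∀ s, g s = p.eval s)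
    (R : ℝ) (h : ∀ x : ℝ, R ≤ x → g x = 0) (s : ℂ) : g s = 0 := by
  obtain ⟨p, hp⟩ := hg
  have : p = 0 := by
    refine Polynomial.eq_zero_of_infinite_isRoot p
      (Set.Infinite.mono ?_ ((Set.Ici_infinite R).image Complex.ofReal_injective.injOn))
    rintro _ ⟨x, hx, rfl⟩
    exact (hp x).symm.trans (h x hx)
  rw [hp, this, Polynomial.eval_zero]

/-- A polynomial function growing at most linearly is affine. -/
lemma affine_of_linear_growth (p : Polynomial ℂ) (a b : ℝ)
    (h : ∀ t : ℝ, 0 ≤ t → ‖p.eval (t : ℂ)‖ ≤ a + b * t) :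
    ∀ t, p.eval t = p.eval 0 + t * (p.eval 1 - p.eval 0) := by
  have hdeg : p.natDegree ≤ 1 := by
    by_contra hc
    push Not at hc
    set q : Polynomial ℂ := p.divX with hq
    have hqd : 0 < q.degree := by
      rw [← Polynomial.natDegree_pos_iff_degree_pos, hq, Polynomial.natDegree_divX_eq_natDegree_tsub_one]
      omega
    have ht : Filter.Tendsto (fun t : ℝ => ‖q.eval (t : ℂ)‖) Filter.atTop Filter.atTop := by
      refine Polynomial.tendsto_norm_atTop q hqd ?_
      simp only [Complex.norm_real]
      exact Filter.tendsto_abs_atTop_atTop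
    obtain ⟨t, ht1, ht2⟩ := ((ht.eventually_gt_atTop (|a| + |b| + ‖p.coeff 0‖)).and
      (Filter.eventually_ge_atTop (1 : ℝ))).exists
    have hpe : p.eval (t : ℂ) = q.eval (t : ℂ) * t + p.coeff 0 := by
      conv_lhs => rw [← Polynomial.divX_mul_X_add p]
      simp [hq]
    have h1 := h t (by linarith)
    have h2 : ‖q.eval (t : ℂ)‖ * t ≤ ‖p.eval (t : ℂ)‖ + ‖p.coeff 0‖ := by
      have : q.eval (t : ℂ) * t = p.eval (t : ℂ) - p.coeff 0 := by rw [hpe]; ring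
      calc ‖q.eval (t : ℂ)‖ * t = ‖q.eval (t : ℂ) * t‖ := by
            rw [norm_mul, Complex.norm_real, Real.norm_of_nonneg (by linarith)]
        _ ≤ _ := by rw [this]; exact norm_sub_le _ _
    have h3 : (|a| + |b| + ‖p.coeff 0‖) * t < ‖q.eval (t : ℂ)‖ * t :=
      mul_lt_mul_of_pos_right ht1 (by linarith)
    nlinarith [le_abs_self a, le_abs_self b, abs_nonneg a, abs_nonneg b, norm_nonneg (p.coeff 0)]
  obtain ⟨c, k, hck⟩ := Polynomial.exists_eq_X_add_C_of_natDegree_le_one hdeg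
  intro t
  rw [hck]
  simp
  ring

/-! ### Hyperbolic polynomial functions and their cones -/

/-- Complexification of a real vector. -/
def cvec {m : ℕ} (x : Fin m → ℝ) : Fin m → ℂ := fun i => (x i : ℂ)

/-- The imaginary part of a complex vector. -/
def imvec {m : ℕ} (Z : Fin m → ℂ) : Fin m → ℝ := fun i => (Z i).im

lemma cvec_add {m : ℕ} (x y : Fin m → ℝ) : cvec (x + y) = cvec x + cvec y := by
  ext i; simp [cvec]

lemma cvec_sub {m : ℕ} (x y : Fin m → ℝ) : cvec (x - y) = cvec x - cvec y := by
  ext i; simp [cvec]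

lemma cvec_smul {m : ℕ} (c : ℝ) (x : Fin m → ℝ) : cvec (c • x) = (c : ℂ) • cvec x := by
  ext i; simp [cvec]

lemma cvec_neg {m : ℕ} (x : Fin m → ℝ) : cvec (-x) = -cvec x := by
  ext i; simp [cvec]

lemma star_cvec {m : ℕ} (x : Fin m → ℝ) : star (cvec x) = cvec x := by
  ext i; simp [cvec]

lemma continuous_cvec {m : ℕ} : Continuous (cvec : (Fin m → ℝ) → Fin m → ℂ) := by
  unfold cvec; fun_prop

lemma exists_re_im {m : ℕ} (Z : Fin m → ℂ) :
    ∃ A : Fin m → ℝ, Z = cvec A + Complex.I • cvec (imvec Z) := by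
  refine ⟨fun i => (Z i).re, ?_⟩
  ext i
  simp only [cvec, imvec, Pi.add_apply, Pi.smul_apply, smul_eq_mul]
  rw [mul_comm, Complex.re_add_im]

/-- A function on `ℂ^m` behaving like the complexification of a real homogeneous polynomial of
degree `d` which is hyperbolic with respect to `e`. -/
structure HyperbolicFun {m : ℕ} (f : (Fin m → ℂ) → ℂ) (d : ℕ) (e : Fin m → ℝ) : Prop where
  cont : Continuous f
  line : ∀ Z W, ∃ p : Polynomial ℂ, ∀ s : ℂ, f (Z + s • W) = p.eval s
  homog : ∀ (s : ℂ) Z, f (s • Z) = s ^ d * f Z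
  star_map : ∀ Z, f (star Z) = star (f Z)
  real_rooted : ∀ (A : Fin m → ℝ) (s : ℂ), s.im ≠ 0 → f (cvec A + s • cvec e) ≠ 0
  pos : 0 < (f (cvec e)).re

/-- The open hyperbolicity cone of `f` with respect to `e`. -/
def openCone {m : ℕ} (f : (Fin m → ℂ) → ℂ) (e : Fin m → ℝ) : Set (Fin m → ℝ) :=
  {y | ∀ t : ℝ, 0 ≤ t → f (cvec (y + t • e)) ≠ 0}

/-- The closed hyperbolicity cone of `f` with respect to `e`. -/
def closedCone {m : ℕ} (f : (Fin m → ℂ) → ℂ) (e : Fin m → ℝ) : Set (Fin m → ℝ) :=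
  {y | ∀ t : ℝ, 0 < t → y + t • e ∈ openCone f e}

namespace HyperbolicFun

variable {m d : ℕ} {f : (Fin m → ℂ) → ℂ} {e : Fin m → ℝ}

lemma ne_zero (hf : HyperbolicFun f d e) : f (cvec e) ≠ 0 := by
  intro h
  have := hf.pos
  simp [h] at this

lemma im_eq_zero (hf : HyperbolicFun f d e) (x : Fin m → ℝ) : (f (cvec x)).im = 0 := by
  have := hf.star_map (cvec x)
  rw [star_cvec] at this
  exact Complex.conj_eq_iff_im.mp this.symm

lemma smul_ne_zero (hf : HyperbolicFun f d e) {s : ℂ} (hs : s ≠ 0) {Z : Fin m → ℂ}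
    (hZ : f Z ≠ 0) : f (s • Z) ≠ 0 := by
  rw [hf.homog]
  exact mul_ne_zero (pow_ne_zero _ hs) hZ

lemma e_mem (hf : HyperbolicFun f d e) : e ∈ openCone f e := by
  intro t ht
  have : cvec (e + t • e) = ((1 + t : ℝ) : ℂ) • cvec e := by
    rw [← cvec_smul]; congr 1; module
  rw [this]
  exact hf.smul_ne_zero (by norm_cast; linarith) hf.ne_zero

lemma openCone_ne_zero {y : Fin m → ℝ} (hy : y ∈ openCone f e) : f (cvec y) ≠ 0 := by
  simpa using hy 0 le_rfl

lemma openCone_add_smul {y : Fin m → ℝ} (hy : y ∈ openCone f e) {t : ℝ} (ht : 0 ≤ t) :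
    y + t • e ∈ openCone f e := by
  intro t' ht'
  have := hy (t + t') (by linarith)
  rwa [add_smul, ← add_assoc] at this

lemma openCone_smul (hf : HyperbolicFun f d e) {y : Fin m → ℝ} (hy : y ∈ openCone f e) {c : ℝ}
    (hc : 0 < c) : c • y ∈ openCone f e := by
  intro t ht
  have : cvec (c • y + t • e) = (c : ℂ) • cvec (y + (t / c) • e) := by
    rw [← cvec_smul]; congr 1; rw [smul_add, smul_smul, mul_div_cancel₀ _ hc.ne']
  rw [this]
  exact hf.smul_ne_zero (by exact_mod_cast hc.ne') (hy _ (by positivity))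

lemma openCone_sub_smul (hf : HyperbolicFun f d e) {y : Fin m → ℝ} (hy : y ∈ openCone f e) :
    ∃ ε : ℝ, 0 < ε ∧ y - ε • e ∈ openCone f e := by
  have hc : Continuous fun t : ℝ => f (cvec (y + t • e)) :=
    hf.cont.comp (continuous_cvec.comp (by fun_prop))
  have h0 : ∀ᶠ t in nhds (0 : ℝ), f (cvec (y + t • e)) ≠ 0 :=
    hc.continuousAt.eventually_ne (hy 0 le_rfl)
  obtain ⟨ε, hε, h⟩ := Metric.eventually_nhds_iff.mp h0
  refine ⟨ε / 2, by linarith, fun t ht => ?_⟩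
  have hv : y - (ε / 2) • e + t • e = y + (t - ε / 2) • e := by module
  rw [hv]
  by_cases h2 : ε / 2 ≤ t
  · exact hy _ (by linarith)
  · apply h
    rw [Real.dist_eq, abs_lt]
    constructor <;> linarith

/-- The zeros of `s ↦ f (s B + Y)` are bounded, uniformly in bounded `Y`. -/
lemma zeros_bounded (hf : HyperbolicFun f d e) {B : Fin m → ℂ} (hB : f B ≠ 0) (K : ℝ) :
    ∃ R : ℝ, ∀ Y : Fin m → ℂ, ‖Y‖ ≤ K → ∀ s : ℂ, f (s • B + Y) = 0 → ‖s‖ ≤ R := by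
  obtain ⟨ε, hε, h⟩ := Metric.eventually_nhds_iff.mp (hf.cont.continuousAt.eventually_ne hB)
  refine ⟨(|K| + 1) / ε, fun Y hY s hs => ?_⟩
  by_contra hc
  push Not at hc
  have hpos : 0 < ‖s‖ := lt_of_le_of_lt (by positivity) hc
  have hs0 : s ≠ 0 := norm_pos_iff.mp hpos
  have hne : f (B + s⁻¹ • Y) ≠ 0 := by
    apply h
    rw [dist_eq_norm, add_sub_cancel_left, norm_smul, norm_inv, inv_mul_lt_iff₀ hpos]
    rw [div_lt_iff₀ hε] at hc
    linarith [le_abs_self K]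
  apply hf.smul_ne_zero hs0 hne
  rwa [smul_add, smul_smul, mul_inv_cancel₀ hs0, one_smul]

lemma base_zero_free (hf : HyperbolicFun f d e) {B : Fin m → ℝ} (hB : B ∈ openCone f e) {α : ℝ}
    (hα : 0 < α) (s : ℂ) (hs : 0 ≤ s.im) :
    f (s • cvec B + (α * Complex.I) • cvec e) ≠ 0 := by
  have hαI : (α * Complex.I : ℂ) ≠ 0 := mul_ne_zero (by exact_mod_cast hα.ne') Complex.I_ne_zero
  by_cases hs0 : s = 0
  · rw [hs0, zero_smul, zero_add]
    exact hf.smul_ne_zero hαI hf.ne_zero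
  · have : s • cvec B + (α * Complex.I) • cvec e
        = s • (cvec B + (α * Complex.I / s) • cvec e) := by
      rw [smul_add, smul_smul, mul_div_cancel₀ _ hs0]
    rw [this]
    apply hf.smul_ne_zero hs0
    by_cases him : (α * Complex.I / s).im = 0
    · have hre : 0 ≤ (α * Complex.I / s).re := by
        rw [Complex.div_re]
        simp only [Complex.mul_re, Complex.ofReal_re, Complex.I_re, Complex.ofReal_im, Complex.I_im,
          Complex.mul_im]
        have := Complex.normSq_nonneg s
        have h1 : 0 ≤ α * s.im / Complex.normSq s := by positivity
        simpa using h1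
      have := hB _ hre
      rw [cvec_add, cvec_smul] at this
      convert this using 4
      apply Complex.ext
      · simp only [Complex.ofReal_re]
      · rw [him, Complex.ofReal_im]
    · exact hf.real_rooted _ _ him

lemma line' (hf : HyperbolicFun f d e) (Z W : Fin m → ℂ) :
    ∃ p : Polynomial ℂ, ∀ s : ℂ, f (s • W + Z) = p.eval s := by
  obtain ⟨p, hp⟩ := hf.line Z W
  exact ⟨p, fun s => by rw [add_comm, hp]⟩

/-- Stability: `f` does not vanish where the imaginary part lies in the open cone. -/
lemma stable (hf : HyperbolicFun f d e) {B : Fin m → ℝ} (hB : B ∈ openCone f e)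
    (A : Fin m → ℝ) : f (cvec A + Complex.I • cvec B) ≠ 0 := by
  obtain ⟨ε, hε, hB'⟩ := hf.openCone_sub_smul hB
  set B' := B - ε • e with hB'def
  obtain ⟨R, hR⟩ := hf.zeros_bounded (openCone_ne_zero hB')
    (‖(ε * Complex.I) • cvec e‖ + ‖cvec A‖)
  have := upper_zero_free_of_path
    (fun r s => f (s • cvec B' + ((ε * Complex.I) • cvec e + (r : ℂ) • cvec A)))
    (hf.cont.comp (by fun_prop)) (fun r => hf.line' _ _) R ?_ ?_ ?_ Complex.I (by simp)
  · convert this using 2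
    rw [hB'def, cvec_sub, cvec_smul]
    ext i
    simp only [Pi.add_apply, Pi.smul_apply, Pi.sub_apply, smul_eq_mul]
    push_cast
    ring
  · intro r hr s hs
    refine hR _ ((norm_add_le _ _).trans (add_le_add le_rfl ?_)) s hs
    rw [norm_smul, Complex.norm_real, Real.norm_of_nonneg hr.1]
    exact mul_le_of_le_one_left (norm_nonneg _) hr.2
  · intro r _ x
    have := hf.real_rooted (x • B' + r • A) (ε * Complex.I) (by simpa using hε.ne')
    convert this using 2
    rw [cvec_add, cvec_smul, cvec_smul]
    abel
  · intro s hs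
    simpa using hf.base_zero_free hB' hε s hs

lemma openCone_segment (hf : HyperbolicFun f d e) {b : Fin m → ℝ} (hb : b ∈ openCone f e) {r : ℝ}
    (hr : r ∈ Set.Icc (0 : ℝ) 1) : r • b + (1 - r) • e ∈ openCone f e := by
  rcases hr.1.eq_or_lt with h | h
  · rw [← h]; simpa using hf.e_mem
  · exact openCone_add_smul (hf.openCone_smul hb h) (by linarith [hr.2])

lemma two_cone_zero_free (hf : HyperbolicFun f d e) {a b : Fin m → ℝ} (ha : a ∈ openCone f e)
    (hb : b ∈ openCone f e) (s : ℂ) (hs : 0 ≤ s.im) :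
    f (s • cvec a + Complex.I • cvec b) ≠ 0 := by
  obtain ⟨R, hR⟩ := hf.zeros_bounded (openCone_ne_zero ha) (‖cvec b‖ + ‖cvec e‖)
  have := upper_zero_free_of_path
    (fun r s => f (s • cvec a + Complex.I • ((r : ℂ) • cvec b + ((1 : ℂ) - r) • cvec e)))
    (hf.cont.comp (by fun_prop)) (fun r => hf.line' _ _) R ?_ ?_ ?_ s hs
  · simpa using this
  · intro r hr s hs
    refine hR _ ?_ s hs
    rw [norm_smul, Complex.norm_I, one_mul]
    refine (norm_add_le _ _).trans (add_le_add ?_ ?_)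
    · rw [norm_smul, Complex.norm_real, Real.norm_of_nonneg hr.1]
      exact mul_le_of_le_one_left (norm_nonneg _) hr.2
    · rw [norm_smul]
      have : ((1 : ℂ) - r) = ((1 - r : ℝ) : ℂ) := by push_cast; rfl
      rw [this, Complex.norm_real, Real.norm_of_nonneg (by linarith [hr.2])]
      exact mul_le_of_le_one_left (norm_nonneg _) (by linarith [hr.1])
  · intro r hr x
    have := hf.stable (hf.openCone_segment hb hr) (x • a)
    convert this using 2
    rw [cvec_add, cvec_smul, cvec_smul, cvec_smul]
    push_cast
    rfl
  · intro s hs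
    simpa using hf.base_zero_free ha one_pos s hs

lemma openCone_add (hf : HyperbolicFun f d e) {a b : Fin m → ℝ} (ha : a ∈ openCone f e)
    (hb : b ∈ openCone f e) : a + b ∈ openCone f e := by
  intro t ht h
  apply hf.two_cone_zero_free ha (openCone_add_smul hb ht) Complex.I (by simp)
  rw [← smul_add, ← cvec_add, ← add_assoc, hf.homog, h, mul_zero]

lemma norm_le_norm_add (hf : HyperbolicFun f d e) {a b : Fin m → ℝ} (ha : a ∈ openCone f e)
    (hb : b ∈ openCone f e) : ‖f (cvec b)‖ ≤ ‖f (cvec (b + a))‖ := by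
  obtain ⟨p, hp⟩ := hf.line' (Complex.I • cvec b) (cvec a)
  have := norm_eval_le_of_upper_zero_free p
    (fun s hs => hp s ▸ hf.two_cone_zero_free ha hb s hs) 0 le_rfl 1 zero_le_one
  rw [← hp, ← hp] at this
  have h1 : (0 + ((1 : ℝ) : ℂ) * Complex.I) • cvec a + Complex.I • cvec b
      = Complex.I • cvec (b + a) := by
    rw [cvec_add]; push_cast; module
  rw [h1, zero_smul, zero_add, hf.homog, hf.homog] at this
  simpa using this

lemma openCone_subset_closedCone {y : Fin m → ℝ} (hy : y ∈ openCone f e) :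
    y ∈ closedCone f e := fun _ ht => openCone_add_smul hy ht.le

lemma open_add_closed (hf : HyperbolicFun f d e) {a b : Fin m → ℝ} (ha : a ∈ openCone f e)
    (hb : b ∈ closedCone f e) : a + b ∈ openCone f e := by
  obtain ⟨ε, hε, h⟩ := hf.openCone_sub_smul ha
  have := hf.openCone_add h (hb ε hε)
  convert this using 1
  module

lemma closed_add (hf : HyperbolicFun f d e) {a b : Fin m → ℝ} (ha : a ∈ closedCone f e)
    (hb : b ∈ closedCone f e) : a + b ∈ closedCone f e := by
  intro t ht
  have := hf.openCone_add (ha (t / 2) (by linarith)) (hb (t / 2) (by linarith))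
  convert this using 1
  module

lemma closed_smul (hf : HyperbolicFun f d e) {a : Fin m → ℝ} (ha : a ∈ closedCone f e) {c : ℝ}
    (hc : 0 ≤ c) : c • a ∈ closedCone f e := by
  intro t ht
  rcases hc.eq_or_lt with h | h
  · rw [← h, zero_smul, zero_add]
    exact hf.openCone_smul hf.e_mem ht
  · have := hf.openCone_smul (ha (t / c) (by positivity)) h
    rwa [smul_add, smul_smul, mul_div_cancel₀ _ h.ne'] at this

lemma re_pos (hf : HyperbolicFun f d e) {y : Fin m → ℝ} (hy : y ∈ openCone f e) :
    0 < (f (cvec y)).re := by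
  by_contra hc
  push Not at hc
  have hcont : Continuous fun r : ℝ => (f (cvec (r • y + (1 - r) • e))).re :=
    Complex.continuous_re.comp (hf.cont.comp (continuous_cvec.comp (by fun_prop)))
  obtain ⟨r, hr, h⟩ := intermediate_value_Icc' zero_le_one hcont.continuousOn
    (show (0 : ℝ) ∈ Set.Icc _ _ from ⟨by simpa using hc, by simpa using hf.pos.le⟩)
  exact openCone_ne_zero (hf.openCone_segment hy hr) (Complex.ext h (hf.im_eq_zero _))

lemma exists_smul_add_mem (hf : HyperbolicFun f d e) (w : Fin m → ℝ) :
    ∃ K : ℝ, 0 < K ∧ ∀ s, K ≤ s → w + s • e ∈ openCone f e := by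
  obtain ⟨R, hR⟩ := hf.zeros_bounded hf.ne_zero ‖cvec w‖
  refine ⟨|R| + 1, by positivity, fun s hs t ht h => ?_⟩
  have := hR (cvec w) le_rfl ((s + t : ℝ) : ℂ) (by
    rw [← h, ← cvec_smul, ← cvec_add]; congr 2; module)
  rw [Complex.norm_real, Real.norm_eq_abs] at this
  linarith [le_abs_self (s + t), le_abs_self R]

/-- If `f` grows at most linearly along `v` from multiples of `e`, it is affine along `v`. -/
lemma affine_along (hf : HyperbolicFun f d e) {v : Fin m → ℝ} (hv : v ∈ closedCone f e)
    (hgrow : ∀ K : ℝ, 0 < K → ∃ a b : ℝ, ∀ t : ℝ, 0 ≤ t → ‖f (cvec (K • e + t • v))‖ ≤ a + b * t)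
    (Z : Fin m → ℂ) (t : ℂ) :
    f (Z + t • cvec v) = f Z + t * (f (Z + cvec v) - f Z) := by
  have step1 : ∀ w ∈ openCone f e, ∀ t : ℂ,
      f (cvec w + t • cvec v) = f (cvec w) + t * (f (cvec w + cvec v) - f (cvec w)) := by
    intro w hw
    obtain ⟨K, hK, hKw⟩ := hf.exists_smul_add_mem (-w)
    obtain ⟨a, b, hab⟩ := hgrow K hK
    obtain ⟨p, hp⟩ := hf.line (cvec w) (cvec v)
    have := affine_of_linear_growth p a b ?_
    · intro t
      have h0 := hp 0
      have h1 := hp 1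
      rw [zero_smul, add_zero] at h0
      rw [one_smul] at h1
      rw [hp, h0, h1, this t]
    · intro t ht
      rw [← hp]
      refine le_trans ?_ (hab t ht)
      have := hf.norm_le_norm_add (hKw K le_rfl)
        (hf.open_add_closed hw (hf.closed_smul hv ht))
      have h2 : w + t • v + (-w + K • e) = K • e + t • v := by module
      rwa [h2, cvec_add, cvec_smul] at this
  have key : ∀ Z W : Fin m → ℂ, ∀ t : ℂ, ∃ p : Polynomial ℂ, ∀ s : ℂ,
      f ((Z + s • W) + t • cvec v) - (f (Z + s • W) + t * (f ((Z + s • W) + cvec v)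
        - f (Z + s • W))) = p.eval s := by
    intro Z W t
    obtain ⟨p1, h1⟩ := hf.line (Z + t • cvec v) W
    obtain ⟨p2, h2⟩ := hf.line Z W
    obtain ⟨p3, h3⟩ := hf.line (Z + cvec v) W
    refine ⟨p1 - (p2 + Polynomial.C t * (p3 - p2)), fun s => ?_⟩
    rw [add_right_comm, h1, h2, add_right_comm, h3]
    simp
  have step2 : ∀ w : Fin m → ℝ, ∀ t : ℂ,
      f (cvec w + t • cvec v) = f (cvec w) + t * (f (cvec w + cvec v) - f (cvec w)) := by
    intro w t
    obtain ⟨K, hK, hKw⟩ := hf.exists_smul_add_mem w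
    have := eq_zero_of_eventually_real _ (key (cvec w) (cvec e) t) K (fun x hx => by
      rw [← cvec_smul, ← cvec_add, step1 _ (hKw x hx) t, sub_self]) 0
    rw [zero_smul, add_zero] at this
    exact sub_eq_zero.mp this
  obtain ⟨A, hA⟩ := exists_re_im Z
  have := eq_zero_of_eventually_real _ (key (cvec A) (cvec (imvec Z)) t) 0 (fun x _ => by
      rw [← cvec_smul, ← cvec_add, step2 _ t, sub_self]) Complex.I
  rw [← hA] at this
  exact sub_eq_zero.mp this

end HyperbolicFun

/-! ### Differences along a vector of functions of two variables -/

/-- The first order difference of `H` along the diagonal direction `(u, u)`. -/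
def linDiff {E R : Type*} [Add E] [Ring R] (u : E) (H : E → E → R) (M N : E) : R :=
  H (M + u) N + H M (N + u) - 2 * H M N

/-- The mixed second order difference of `H` along `u` in both arguments. -/
def mixDiff {E R : Type*} [Add E] [Ring R] (u : E) (H : E → E → R) (M N : E) : R :=
  H (M + u) (N + u) - H (M + u) N - H M (N + u) + H M N

/-- `H` is affine along `u` in each of its arguments. -/
def AffineAlong {R E : Type*} [CommRing R] [AddCommGroup E] [Module R E] (u : E)
    (H : E → E → R) : Prop :=
  (∀ M N (t : R), H (M + t • u) N = H M N + t * (H (M + u) N - H M N)) ∧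
    ∀ M N (t : R), H M (N + t • u) = H M N + t * (H M (N + u) - H M N)

namespace AffineAlong

variable {R E : Type*} [CommRing R] [AddCommGroup E] [Module R E] {u : E} {H : E → E → R}

lemma expand (hH : AffineAlong u H) (M N : E) (y z : R) :
    H (M + y • u) (N + z • u) = H M N + y * (H (M + u) N - H M N) + z * (H M (N + u) - H M N)
      + y * z * mixDiff u H M N := by
  rw [hH.1, hH.2, hH.2, mixDiff]
  ring

lemma diag (hH : AffineAlong u H) (M N : E) (t : R) :
    H (M + t • u) (N + t • u) = H M N + linDiff u H M N * t + mixDiff u H M N * t ^ 2 := by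
  rw [hH.expand, linDiff]
  ring

lemma linDiff_diag (hH : AffineAlong u H) (M N : E) (t : R) :
    linDiff u H (M + t • u) (N + t • u) = linDiff u H M N + 2 * mixDiff u H M N * t := by
  have h1 : M + t • u + u = M + (t + 1) • u := by module
  have h2 : N + t • u + u = N + (t + 1) • u := by module
  rw [linDiff, h1, h2, hH.expand, hH.expand, hH.expand, linDiff]
  ring

lemma mixDiff_shift (hH : AffineAlong u H) (M N : E) (y z : R) :
    mixDiff u H (M + y • u) (N + z • u) = mixDiff u H M N := by
  have h1 : M + y • u + u = M + (y + 1) • u := by module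
  have h2 : N + z • u + u = N + (z + 1) • u := by module
  conv_lhs => rw [mixDiff, h1, h2, hH.expand, hH.expand, hH.expand, hH.expand]
  ring

lemma linDiff_linDiff (hH : AffineAlong u H) (M N : E) :
    linDiff u (linDiff u H) M N = 2 * mixDiff u H M N := by
  have h1 := hH.1 (M + u) N (-1)
  have h2 := hH.2 M (N + u) (-1)
  have h3 := hH.1 M N 2
  have h4 := hH.2 M N 2
  have e1 : M + u + u = M + (2 : R) • u := by module
  have e2 : N + u + u = N + (2 : R) • u := by module
  simp only [linDiff, mixDiff, e1, e2, h3, h4]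
  ring

lemma linDiff_affine (hH : AffineAlong u H) (w : E) : AffineAlong u (linDiff w H) := by
  constructor
  · intro M N t
    simp only [linDiff]
    rw [add_right_comm M, hH.1, hH.1, hH.1, add_right_comm M u]
    ring
  · intro M N t
    simp only [linDiff]
    rw [add_right_comm N, hH.2, hH.2, hH.2, add_right_comm N u]
    ring

lemma smul (hH : AffineAlong u H) (c : R) : AffineAlong (c • u) H := by
  constructor
  · intro M N t
    rw [smul_smul, hH.1, hH.1 M N c]
    ring
  · intro M N t
    rw [smul_smul, hH.2, hH.2 M N c]
    ring

lemma mixDiff_smul (hH : AffineAlong u H) (c : R) (M N : E) :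
    mixDiff (c • u) H M N = c ^ 2 * mixDiff u H M N := by
  simp only [mixDiff]
  rw [hH.expand, hH.1, hH.2, mixDiff]
  ring

end AffineAlong

lemma linDiff_mixDiff_comm {E R : Type*} [AddCommGroup E] [Ring R] (u w : E) (H : E → E → R)
    (M N : E) : linDiff w (mixDiff u H) M N = mixDiff u (linDiff w H) M N := by
  simp only [linDiff, mixDiff, add_right_comm _ w u]
  noncomm_ring

/-! ### The two inequalities behind the argument -/

/-- A bi-affine polynomial without zeros in the product of closed upper half-planes has distinct
constant and mixed coefficients. -/
lemma const_ne_mixed (A B C D : ℂ)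
    (h : ∀ y z : ℂ, 0 ≤ y.im → 0 ≤ z.im → A + y * B + z * C + y * z * D ≠ 0) : A ≠ D := by
  have aux : ∀ A B C : ℂ, B ≠ 0 → ¬ ∀ y z : ℂ, 0 ≤ y.im → 0 ≤ z.im →
      A + y * B + z * C + y * z * A ≠ 0 := by
    intro A B C hB h
    have hA : A ≠ 0 := by simpa using h 0 0 le_rfl le_rfl
    have hb : 0 < (-(B / A)).im := by
      by_contra hc
      push Not at hc
      have hy : 0 ≤ (-(A / B)).im := by
        have hinv : -(A / B) = (-(B / A))⁻¹ := by rw [inv_neg, inv_div]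
        rw [hinv, Complex.inv_im]
        exact div_nonneg (by linarith) (Complex.normSq_nonneg _)
      apply h _ 0 hy le_rfl
      field_simp
      ring
    set b := B / A with hbdef
    set c := C / A with hcdef
    have hc1 : Continuous fun ε : ℝ => (1 : ℂ) - Complex.I * c * ε := by fun_prop
    have hne : ∀ᶠ ε : ℝ in nhds 0, (1 : ℂ) - Complex.I * c * ε ≠ 0 :=
      hc1.continuousAt.eventually_ne (by simp)
    have hca : ContinuousAt (fun ε : ℝ => ((Complex.I * ε - b) / (1 - Complex.I * c * ε)).im) 0 := by
      refine Complex.continuous_im.continuousAt.comp (ContinuousAt.div ?_ hc1.continuousAt (by simp))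
      fun_prop
    have hpos : ∀ᶠ ε : ℝ in nhds 0, 0 < ((Complex.I * ε - b) / (1 - Complex.I * c * ε)).im :=
      hca.eventually (lt_mem_nhds (by simpa using hb))
    obtain ⟨ε, ⟨h1, h2⟩, h3⟩ := (((hne.and hpos).filter_mono nhdsWithin_le_nhds).and
      (self_mem_nhdsWithin : Set.Ioi (0 : ℝ) ∈ nhdsWithin 0 (Set.Ioi 0))).exists
    have h3' : (0 : ℝ) < ε := h3
    have hε : (ε : ℂ) ≠ 0 := by exact_mod_cast h3'.ne'
    apply h (Complex.I / ε) _ ?_ h2.le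
    · have hB' : B = b * A := by rw [hbdef]; field_simp
      have hC' : C = c * A := by rw [hcdef]; field_simp
      have hw := div_mul_cancel₀ (Complex.I * ε - b) h1
      generalize (Complex.I * ε - b) / (1 - Complex.I * c * ε) = w at hw
      have hfac : A + Complex.I / ε * B + w * C + Complex.I / ε * w * A
          = A / ε * (ε + Complex.I * b + w * c * ε + Complex.I * w) := by
        rw [hB', hC']; field_simp
      rw [hfac]
      refine mul_eq_zero_of_right _ ?_
      linear_combination Complex.I * hw + (ε + w * c * ε) * Complex.I_sq
    · rw [Complex.div_ofReal_im, Complex.I_im]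
      positivity
  rintro rfl
  by_cases hB : B = 0
  · by_cases hC : C = 0
    · apply h Complex.I Complex.I (by simp) (by simp)
      rw [hB, hC]
      simp
    · exact aux A C B hC fun y z hy hz hh => h z y hz hy (by linear_combination hh)
  · exact aux A B C hB h

/-- The one-variable barrier estimate. -/
lemma barrier_shift (α β γ κ₀ κ₁ κ₂ δ δ' : ℝ) (hα : 0 < α)
    (hP : ∀ t, 0 ≤ t → 0 < α + β * t + γ * t ^ 2) (hβ : β ≤ δ * α) (hκ : κ₀ ≤ δ' * α)
    (hδ : 0 ≤ δ)
    (hV : ∀ t, (κ₁ + 2 * κ₂ * t) * (α + β * t + γ * t ^ 2)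
      ≤ (κ₀ + κ₁ * t + κ₂ * t ^ 2) * (β + 2 * γ * t))
    (hV' : ∀ t, 2 * γ * (α + β * t + γ * t ^ 2) ≤ (β + 2 * γ * t) * (β + 2 * γ * t)) :
    0 < α + β * δ + γ * δ ^ 2 - γ ∧
      κ₀ + κ₁ * δ + κ₂ * δ ^ 2 - κ₂ ≤ δ' * (α + β * δ + γ * δ ^ 2 - γ) := by
  have hγ : 0 ≤ γ := by
    by_contra hc
    push Not at hc
    have h1 := hP ((|β| + α + 1) / (-γ) + 1)
      (by have : 0 < -γ := by linarith
          positivity)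
    set t := (|β| + α + 1) / (-γ) + 1 with ht
    have h2 : (t - 1) * (-γ) = |β| + α + 1 := by
      rw [ht, add_sub_cancel_right, div_mul_cancel₀ _ (by linarith)]
    have ht1 : 1 ≤ t := by
      have : 0 ≤ (|β| + α + 1) / (-γ) := div_nonneg (by positivity) (by linarith)
      linarith
    nlinarith [le_abs_self β, abs_nonneg β]
  have hdisc : 4 * γ * α ≤ β ^ 2 := by
    rcases hγ.eq_or_lt with h | h
    · rw [← h]; nlinarith [sq_nonneg β]
    · have := hV' (-β / (2 * γ))
      have e1 : β + 2 * γ * (-β / (2 * γ)) = 0 := by field_simp; ring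
      have e2 : 2 * γ * (α + β * (-β / (2 * γ)) + γ * (-β / (2 * γ)) ^ 2)
          = (4 * γ * α - β ^ 2) / 2 := by field_simp; ring
      rw [e1, e2] at this
      linarith
  have hβ0 : 0 ≤ β := by
    by_contra hc
    push Not at hc
    rcases hγ.eq_or_lt with h | h
    · have := hP (α / (-β)) (div_nonneg hα.le (by linarith))
      have e1 : α + β * (α / (-β)) + γ * (α / (-β)) ^ 2 = 0 := by
        have hb : β ≠ 0 := hc.ne
        rw [← h, div_neg]; field_simp; ring
      linarith
    · have := hP (-β / (2 * γ)) (div_nonneg (by linarith) (by linarith))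
      have e2 : α + β * (-β / (2 * γ)) + γ * (-β / (2 * γ)) ^ 2
          = (4 * γ * α - β ^ 2) / (4 * γ) := by field_simp; ring
      rw [e2] at this
      have := div_nonpos_of_nonpos_of_nonneg (show 4 * γ * α - β ^ 2 ≤ 0 by linarith)
        (show 0 ≤ 4 * γ by linarith)
      linarith
  have hpos : 0 < α + β * δ + γ * δ ^ 2 - γ := by
    have h1 : 4 * γ * α ≤ (δ * α) ^ 2 := hdisc.trans (pow_le_pow_left₀ hβ0 hβ 2)
    have h2 : 4 * γ ≤ δ ^ 2 * α := by nlinarith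
    by_cases h1' : 1 ≤ δ ^ 2
    · nlinarith [mul_nonneg hβ0 hδ]
    · nlinarith [mul_nonneg hβ0 hδ, mul_nonneg hγ (sq_nonneg δ)]
  refine ⟨hpos, ?_⟩
  set v₀ := κ₀ * β - κ₁ * α with hv₀
  set v₁ := 2 * (κ₀ * γ - κ₂ * α) with hv₁
  set v₂ := κ₁ * γ - κ₂ * β with hv₂
  have hq : ∀ t : ℝ, 0 ≤ v₂ * (t * t) + v₁ * t + v₀ := by
    intro t
    have := hV t
    simp only [hv₀, hv₁, hv₂]
    nlinarith
  have hd : v₁ ^ 2 ≤ 4 * v₀ * v₂ := by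
    have := discrim_le_zero hq
    rw [discrim] at this
    linarith
  have hv0 : 0 ≤ v₀ := by simpa using hq 0
  have hv2 : 0 ≤ v₂ := by
    have h1 := hq 1
    have h2 := hq (-1)
    by_contra hc
    push Not at hc
    have h0 : v₀ = 0 ∨ 0 < v₀ := by
      rcases hv0.eq_or_lt with h | h
      · exact Or.inl h.symm
      · exact Or.inr h
    rcases h0 with h | h
    · nlinarith
    · nlinarith [sq_nonneg v₁, mul_pos h (neg_pos.mpr hc)]
  have hid : α * v₂ + γ * v₀ = β * v₁ / 2 := by
    simp only [hv₀, hv₁, hv₂]; ring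
  have hmain : 0 ≤ v₁ ∧ v₁ / 2 ≤ δ * v₀ := by
    rcases hβ0.eq_or_lt with h | h
    · have h2 : v₂ = 0 := by
        rw [← h] at hid
        have := mul_nonneg hγ hv0
        have := mul_nonneg hα.le hv2
        have h3 : α * v₂ = 0 := by linarith
        exact (mul_eq_zero.mp h3).resolve_left hα.ne'
      have h1 : v₁ = 0 := by
        rw [h2, mul_zero] at hd
        exact pow_eq_zero_iff two_ne_zero |>.mp (le_antisymm hd (sq_nonneg _))
      rw [h1]
      exact ⟨le_rfl, by simpa using mul_nonneg hδ hv0⟩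
    · have hv1 : 0 ≤ v₁ := by
        have : 0 ≤ β * v₁ / 2 := by
          rw [← hid]; exact add_nonneg (mul_nonneg hα.le hv2) (mul_nonneg hγ hv0)
        by_contra hc
        push Not at hc
        nlinarith
      refine ⟨hv1, ?_⟩
      rcases hv1.eq_or_lt with h1 | h1
      · rw [← h1]; simpa using mul_nonneg hδ hv0
      · have h2 : α * v₂ ≤ β * v₁ / 2 := by linarith [mul_nonneg hγ hv0]
        have h3 : α * v₁ ^ 2 ≤ 2 * β * v₀ * v₁ := by nlinarith
        have h4 : α * v₁ ≤ 2 * β * v₀ := by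
          by_contra hc
          push Not at hc
          nlinarith
        have h5 : β * v₀ ≤ δ * α * v₀ := mul_le_mul_of_nonneg_right hβ hv0
        by_contra hc
        push Not at hc
        nlinarith
  have hfin : α * (κ₀ + κ₁ * δ + κ₂ * δ ^ 2 - κ₂) ≤ κ₀ * (α + β * δ + γ * δ ^ 2 - γ) := by
    have : κ₀ * (α + β * δ + γ * δ ^ 2 - γ) - α * (κ₀ + κ₁ * δ + κ₂ * δ ^ 2 - κ₂)
        = v₀ * δ + v₁ / 2 * (δ ^ 2 - 1) := by
      simp only [hv₀, hv₁]; ring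
    nlinarith [mul_nonneg hmain.1 (sq_nonneg δ), hmain.2]
  have h6 := mul_le_mul_of_nonneg_right hκ hpos.le
  have h7 : α * (κ₀ + κ₁ * δ + κ₂ * δ ^ 2 - κ₂) ≤ α * (δ' * (α + β * δ + γ * δ ^ 2 - γ)) := by
    linarith
  exact le_of_mul_le_mul_left h7 hα

/-! ### Stable functions of two variables -/

/-- Functions of two vector variables which are stable with respect to the hyperbolicity cone in
both, affine along the vectors `v j` in each variable, and of degree `D` along the diagonal
direction `(e, e)`, with leading coefficient `c`. -/
structure StablePair {m n : ℕ} (f : (Fin m → ℂ) → ℂ) (e : Fin m → ℝ) (v : Fin n → Fin m → ℝ)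
    (D : ℕ) (c : ℂ) (G : (Fin m → ℂ) → (Fin m → ℂ) → ℂ) : Prop where
  cont : Continuous fun z : (Fin m → ℂ) × (Fin m → ℂ) => G z.1 z.2
  line : ∀ M M' N N', ∃ p : Polynomial ℂ, ∀ s : ℂ, G (M + s • M') (N + s • N') = p.eval s
  star_map : ∀ M N, G (star M) (star N) = star (G M N)
  aff : ∀ j, AffineAlong (R := ℂ) (cvec (v j)) G
  stable : ∀ M N, imvec M ∈ openCone f e → imvec N ∈ openCone f e → G M N ≠ 0
  growth : ∀ A B, Filter.Tendsto (fun x : ℂ => G (x • cvec e + A) (x • cvec e + B) / x ^ D)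
    (Bornology.cobounded ℂ) (nhds c)

/-- Weighted average of `G` over the shifts of its arguments by `±(a - μ) w`. -/
def avgStep {m : ℕ} (S : Finset ℝ) (p : ℝ → ℝ) (μ : ℝ) (w : Fin m → ℝ)
    (G : (Fin m → ℂ) → (Fin m → ℂ) → ℂ) (M N : Fin m → ℂ) : ℂ :=
  ∑ a ∈ S, (p a : ℂ) * G (M + ((a - μ : ℝ) : ℂ) • cvec w) (N - ((a - μ : ℝ) : ℂ) • cvec w)

lemma imvec_add_smul_cvec {m : ℕ} (M : Fin m → ℂ) (y : ℂ) (w : Fin m → ℝ) :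
    imvec (M + y • cvec w) = imvec M + y.im • w := by
  ext i
  simp [imvec, cvec]

lemma imvec_sub_smul_cvec {m : ℕ} (M : Fin m → ℂ) (y : ℂ) (w : Fin m → ℝ) :
    imvec (M - y • cvec w) = imvec M - y.im • w := by
  ext i
  simp [imvec, cvec]

lemma AffineAlong.avgStep_eq {m : ℕ} {G : (Fin m → ℂ) → (Fin m → ℂ) → ℂ} {w : Fin m → ℝ}
    (hG : AffineAlong (R := ℂ) (cvec w) G) {S : Finset ℝ} {p : ℝ → ℝ} (hp1 : ∑ a ∈ S, p a = 1)
    (μ : ℝ) {b q : ℝ} (hb : ∑ a ∈ S, p a * (a - μ) = b) (hq : ∑ a ∈ S, p a * (a - μ) ^ 2 = q)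
    (M N : Fin m → ℂ) :
    avgStep S p μ w G M N = G (M + (b : ℂ) • cvec w) (N - (b : ℂ) • cvec w)
      - ((q - b ^ 2 : ℝ) : ℂ) * mixDiff (cvec w) G M N := by
  have h1 : ∑ a ∈ S, (p a : ℂ) = 1 := by exact_mod_cast congrArg (Complex.ofReal) hp1
  have h2 : ∑ a ∈ S, (p a : ℂ) * ((a - μ : ℝ) : ℂ) = b := by rw [← hb]; push_cast; rfl
  have h3 : ∑ a ∈ S, (p a : ℂ) * ((a - μ : ℝ) : ℂ) ^ 2 = q := by rw [← hq]; push_cast; rfl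
  have hs : ∀ t : ℂ, G (M + t • cvec w) (N - t • cvec w) = G M N
      + t * (G (M + cvec w) N - G M (N + cvec w)) - t ^ 2 * mixDiff (cvec w) G M N := by
    intro t
    rw [sub_eq_add_neg, ← neg_smul, hG.expand]
    ring
  rw [hs, avgStep]
  have : ∀ a ∈ S, (p a : ℂ) * G (M + ((a - μ : ℝ) : ℂ) • cvec w) (N - ((a - μ : ℝ) : ℂ) • cvec w)
      = (p a : ℂ) * G M N
        + ((p a : ℂ) * ((a - μ : ℝ) : ℂ)) * (G (M + cvec w) N - G M (N + cvec w))
        - ((p a : ℂ) * ((a - μ : ℝ) : ℂ) ^ 2) * mixDiff (cvec w) G M N := by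
    intro a _
    rw [hs]; ring
  rw [Finset.sum_congr rfl this, Finset.sum_sub_distrib, Finset.sum_add_distrib, ← Finset.sum_mul,
    ← Finset.sum_mul, ← Finset.sum_mul, h1, h2, h3]
  push_cast
  ring

/-- For a centred distribution, averaging subtracts a mixed difference. -/
lemma AffineAlong.avgStep_centered {m : ℕ} {G : (Fin m → ℂ) → (Fin m → ℂ) → ℂ} {w : Fin m → ℝ}
    (hG : AffineAlong (R := ℂ) (cvec w) G) {S : Finset ℝ} {p : ℝ → ℝ} (hp1 : ∑ a ∈ S, p a = 1)
    {μ τ : ℝ} (hμ : μ = ∑ a ∈ S, p a * a) (hτ : τ ^ 2 = ∑ a ∈ S, p a * (a - μ) ^ 2)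
    (M N : Fin m → ℂ) :
    avgStep S p μ w G M N = G M N - mixDiff (cvec (τ • w)) G M N := by
  have hb : ∑ a ∈ S, p a * (a - μ) = 0 := by
    simp only [mul_sub, Finset.sum_sub_distrib, ← Finset.sum_mul, hp1, ← hμ]
    ring
  rw [hG.avgStep_eq hp1 μ hb hτ.symm, cvec_smul, hG.mixDiff_smul]
  simp

namespace StablePair

variable {m n d D : ℕ} {f : (Fin m → ℂ) → ℂ} {e : Fin m → ℝ} {v : Fin n → Fin m → ℝ} {c : ℂ}
  {G : (Fin m → ℂ) → (Fin m → ℂ) → ℂ}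

/-- The product of two copies of a hyperbolic function. -/
lemma of_hyperbolic (hf : HyperbolicFun f d e)
    (haff : ∀ j Z (t : ℂ), f (Z + t • cvec (v j)) = f Z + t * (f (Z + cvec (v j)) - f Z)) :
    StablePair f e v (d + d) (f (cvec e) * f (cvec e)) (fun M N => f M * f N) where
  cont := (hf.cont.comp continuous_fst).mul (hf.cont.comp continuous_snd)
  line M M' N N' := by
    obtain ⟨p, hp⟩ := hf.line M M'
    obtain ⟨q, hq⟩ := hf.line N N'
    exact ⟨p * q, fun s => by simp only [hp, hq, Polynomial.eval_mul]⟩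
  star_map M N := by simp only [hf.star_map, star_mul']
  aff j := by
    constructor
    · intro M N t
      simp only []
      rw [haff]; ring
    · intro M N t
      simp only []
      rw [haff]; ring
  stable M N hM hN := by
    obtain ⟨A, hA⟩ := exists_re_im M
    obtain ⟨B, hB⟩ := exists_re_im N
    rw [hA, hB]
    exact mul_ne_zero (hf.stable hM A) (hf.stable hN B)
  growth A B := by
    have key : ∀ A : Fin m → ℂ, Filter.Tendsto (fun x : ℂ => f (cvec e + x⁻¹ • A))
        (Bornology.cobounded ℂ) (nhds (f (cvec e))) := by
      intro A
      have hc : Continuous fun y : ℂ => f (cvec e + y • A) := hf.cont.comp (by fun_prop)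
      have := (hc.tendsto 0).comp (Filter.tendsto_inv₀_cobounded (α := ℂ))
      simpa [Function.comp_def] using this
    refine ((key A).mul (key B)).congr' ?_
    filter_upwards [Bornology.eventually_ne_cobounded (0 : ℂ)] with x hx
    have hsc : ∀ A : Fin m → ℂ, f (x • cvec e + A) = x ^ d * f (cvec e + x⁻¹ • A) := by
      intro A
      rw [← hf.homog, smul_add, smul_smul, mul_inv_cancel₀ hx, one_smul]
    rw [hsc, hsc, eq_div_iff (pow_ne_zero _ hx), pow_add]
    ring

lemma avgStep (hG : StablePair f e v D c G) (hf : HyperbolicFun f d e) {i : Fin n}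
    (hv : v i ∈ closedCone f e) {S : Finset ℝ} {p : ℝ → ℝ} (hp : ∀ a ∈ S, 0 ≤ p a)
    (hp1 : ∑ a ∈ S, p a = 1) (μ : ℝ) :
    StablePair f e v D c (avgStep S p μ (v i) G) where
  cont := by
    refine continuous_finsetSum _ fun a _ => continuous_const.mul ?_
    exact hG.cont.comp ((continuous_fst.add continuous_const).prodMk
      (continuous_snd.sub continuous_const))
  line M M' N N' := by
    choose P hP using fun a : ℝ => hG.line (M + ((a - μ : ℝ) : ℂ) • cvec (v i)) M'
      (N - ((a - μ : ℝ) : ℂ) • cvec (v i)) N'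
    refine ⟨∑ a ∈ S, Polynomial.C (p a : ℂ) * P a, fun s => ?_⟩
    rw [Polynomial.eval_finsetSum, _root_.avgStep]
    refine Finset.sum_congr rfl fun a _ => ?_
    rw [Polynomial.eval_mul, Polynomial.eval_C, ← hP]
    congr 2 <;> abel
  star_map M N := by
    simp only [_root_.avgStep, star_sum, star_mul']
    refine Finset.sum_congr rfl fun a _ => ?_
    rw [← hG.star_map]
    simp only [star_add, star_sub, star_smul, star_cvec, Complex.star_def, Complex.conj_ofReal]
  aff j := by
    constructor
    · intro M N t
      simp only [_root_.avgStep]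
      rw [← Finset.sum_sub_distrib, Finset.mul_sum, ← Finset.sum_add_distrib]
      refine Finset.sum_congr rfl fun a _ => ?_
      rw [add_right_comm M, (hG.aff j).1, add_right_comm M (cvec (v j))]
      ring
    · intro M N t
      simp only [_root_.avgStep]
      rw [← Finset.sum_sub_distrib, Finset.mul_sum, ← Finset.sum_add_distrib]
      refine Finset.sum_congr rfl fun a _ => ?_
      rw [add_sub_right_comm N, (hG.aff j).2, add_sub_right_comm N (cvec (v j))]
      ring
  stable M N hM hN := by
    set b := ∑ a ∈ S, p a * (a - μ) with hb
    set q := ∑ a ∈ S, p a * (a - μ) ^ 2 with hq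
    have hvar : 0 ≤ q - b ^ 2 := by
      have h1 : q - b ^ 2 = ∑ a ∈ S, p a * (a - μ - b) ^ 2 := by
        have : ∀ a ∈ S, p a * (a - μ - b) ^ 2
            = p a * (a - μ) ^ 2 - 2 * b * (p a * (a - μ)) + b ^ 2 * p a := fun a _ => by ring
        rw [Finset.sum_congr rfl this, Finset.sum_add_distrib, Finset.sum_sub_distrib,
          ← Finset.mul_sum, ← Finset.mul_sum, hp1, ← hb, ← hq]
        ring
      rw [h1]
      exact Finset.sum_nonneg fun a ha => mul_nonneg (hp a ha) (sq_nonneg _)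
    have hshift := (hG.aff i).mixDiff_shift M N (b : ℂ) (-(b : ℂ))
    rw [(hG.aff i).avgStep_eq hp1 μ hb.symm hq.symm, ← hshift, neg_smul, ← sub_eq_add_neg]
    have hM' : imvec (M + (b : ℂ) • cvec (v i)) ∈ openCone f e := by
      rw [imvec_add_smul_cvec]; simpa using hM
    have hN' : imvec (N - (b : ℂ) • cvec (v i)) ∈ openCone f e := by
      rw [imvec_sub_smul_cvec]; simpa using hN
    generalize M + (b : ℂ) • cvec (v i) = M' at *
    generalize N - (b : ℂ) • cvec (v i) = N' at *
    have hsq : ((q - b ^ 2 : ℝ) : ℂ) = (Real.sqrt (q - b ^ 2) : ℂ) ^ 2 := by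
      rw [← Complex.ofReal_pow, Real.sq_sqrt hvar]
    have hs0 := Real.sqrt_nonneg (q - b ^ 2)
    rw [hsq]
    generalize Real.sqrt (q - b ^ 2) = s at *
    refine sub_ne_zero.mpr (const_ne_mixed _ (s * (G (M' + cvec (v i)) N' - G M' N'))
      (s * (G M' (N' + cvec (v i)) - G M' N')) _ fun y z hy hz => ?_)
    have hmem : ∀ (M : Fin m → ℂ) (y : ℂ), imvec M ∈ openCone f e → 0 ≤ y.im →
        imvec (M + ((s : ℂ) * y) • cvec (v i)) ∈ openCone f e := by
      intro M y hM hy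
      rw [imvec_add_smul_cvec, Complex.im_ofReal_mul]
      exact hf.open_add_closed hM (hf.closed_smul hv (mul_nonneg hs0 hy))
    have := hG.stable _ _ (hmem M' y hM' hy) (hmem N' z hN' hz)
    rw [(hG.aff i).expand] at this
    convert this using 1
    ring
  growth A B := by
    have := tendsto_finsetSum S fun a _ =>
      (hG.growth (A + ((a - μ : ℝ) : ℂ) • cvec (v i)) (B - ((a - μ : ℝ) : ℂ) • cvec (v i))).const_mul
        (p a : ℂ)
    rw [← Finset.sum_mul] at this
    have h1 : ∑ a ∈ S, (p a : ℂ) = 1 := by exact_mod_cast congrArg (Complex.ofReal) hp1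
    rw [h1, one_mul] at this
    refine this.congr fun x => ?_
    rw [_root_.avgStep, Finset.sum_div]
    refine Finset.sum_congr rfl fun a _ => ?_
    rw [mul_div_assoc, add_assoc, add_sub_assoc]

end StablePair

/-! ### The barrier argument -/

/-- The restriction to real arguments, as a real function. -/
def realRestrict {m : ℕ} (G : (Fin m → ℂ) → (Fin m → ℂ) → ℂ) (x y : Fin m → ℝ) : ℝ :=
  (G (cvec x) (cvec y)).re

/-- An affine function without zeros in the closed upper half-plane. -/
lemma im_conj_mul_nonpos {P B : ℂ} (h : ∀ s : ℂ, 0 ≤ s.im → P + s * B ≠ 0) :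
    (star P * B).im ≤ 0 := by
  by_contra hc
  push Not at hc
  have hB : B ≠ 0 := by
    rintro rfl
    simp at hc
  apply h (-P / B)
  · have hn := Complex.normSq_pos.mpr hB
    rw [Complex.div_im]
    simp only [Complex.mul_im, Complex.star_def, Complex.conj_re, Complex.conj_im] at hc
    rw [← sub_div]
    refine div_nonneg ?_ hn.le
    simp only [Complex.neg_im, Complex.neg_re]
    linarith
  · field_simp
    ring

lemma le_of_forall_pos_of_continuous {φ : ℝ → ℝ} (hφ : Continuous φ) (h : ∀ ε, 0 < ε → φ ε ≤ 0) :
    φ 0 ≤ 0 := by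
  refine le_of_tendsto (hφ.continuousWithinAt (s := Set.Ioi 0)) ?_
  filter_upwards [self_mem_nhdsWithin] with ε hε using h ε hε

namespace StablePair

variable {m n d D : ℕ} {f : (Fin m → ℂ) → ℂ} {e : Fin m → ℝ} {v : Fin n → Fin m → ℝ} {c : ℂ}
  {G : (Fin m → ℂ) → (Fin m → ℂ) → ℂ}

lemma eq_realRestrict (hG : StablePair f e v D c G) (x y : Fin m → ℝ) :
    G (cvec x) (cvec y) = (realRestrict G x y : ℂ) := by
  have := hG.star_map (cvec x) (cvec y)
  rw [star_cvec, star_cvec] at this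
  exact Complex.ext rfl (by simpa using Complex.conj_eq_iff_im.mp this.symm)

lemma affineAlong_realRestrict (hG : StablePair f e v D c G) {w : Fin m → ℝ}
    (hw : AffineAlong (R := ℂ) (cvec w) G) : AffineAlong (R := ℝ) w (realRestrict G) := by
  constructor
  · intro M N t
    have := hw.1 (cvec M) (cvec N) t
    rw [← cvec_smul, ← cvec_add, ← cvec_add, hG.eq_realRestrict, hG.eq_realRestrict, hG.eq_realRestrict] at this
    exact_mod_cast this
  · intro M N t
    have := hw.2 (cvec M) (cvec N) t
    rw [← cvec_smul, ← cvec_add, ← cvec_add, hG.eq_realRestrict, hG.eq_realRestrict, hG.eq_realRestrict] at this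
    exact_mod_cast this

lemma wronskian_upper (hG : StablePair f e v D c G) (hf : HyperbolicFun f d e) {w : Fin m → ℝ}
    (hw : w ∈ closedCone f e) (hwa : AffineAlong (R := ℂ) (cvec w) G) {M N : Fin m → ℂ}
    (hM : imvec M ∈ openCone f e) (hN : imvec N ∈ openCone f e) :
    (star (G M N) * linDiff (cvec w) G M N).im ≤ 0 := by
  have hmem : ∀ (M : Fin m → ℂ) (s : ℂ), imvec M ∈ openCone f e → 0 ≤ s.im →
      imvec (M + s • cvec w) ∈ openCone f e := by
    intro M s hM hs
    rw [imvec_add_smul_cvec]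
    exact hf.open_add_closed hM (hf.closed_smul hw hs)
  have h1 : (star (G M N) * (G (M + cvec w) N - G M N)).im ≤ 0 :=
    im_conj_mul_nonpos fun s hs => by
      rw [← hwa.1]; exact hG.stable _ _ (hmem M s hM hs) hN
  have h2 : (star (G M N) * (G M (N + cvec w) - G M N)).im ≤ 0 :=
    im_conj_mul_nonpos fun s hs => by
      rw [← hwa.2]; exact hG.stable _ _ hM (hmem N s hN hs)
  have : star (G M N) * linDiff (cvec w) G M N = star (G M N) * (G (M + cvec w) N - G M N)
      + star (G M N) * (G M (N + cvec w) - G M N) := by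
    rw [linDiff]; ring
  rw [this, Complex.add_im]
  linarith

/-- Negativity of the Wronskian of `G` and its first difference, at real points. -/
lemma wronskian (hG : StablePair f e v D c G) (hf : HyperbolicFun f d e) {u w : Fin m → ℝ}
    (hu : u ∈ closedCone f e) (hw : w ∈ closedCone f e)
    (hua : AffineAlong (R := ℂ) (cvec u) G) (hwa : AffineAlong (R := ℂ) (cvec w) G)
    (x y : Fin m → ℝ) :
    linDiff u (linDiff w (realRestrict G)) x y * realRestrict G x y
      ≤ linDiff w (realRestrict G) x y * linDiff u (realRestrict G) x y := by
  have hcont : Continuous fun z : (Fin m → ℂ) × (Fin m → ℂ) =>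
      (star (G z.1 z.2) * linDiff (cvec w) G z.1 z.2).im := by
    refine Complex.continuous_im.comp (hG.cont.star.mul ?_)
    simp only [linDiff]
    exact ((hG.cont.comp ((continuous_fst.add continuous_const).prodMk continuous_snd)).add
      (hG.cont.comp (continuous_fst.prodMk (continuous_snd.add continuous_const)))).sub
      (continuous_const.mul hG.cont)
  have him : ∀ (x b : Fin m → ℝ) (η : ℝ),
      imvec (cvec x + (Complex.I * η) • cvec b) = η • b := by
    intro x b η
    rw [imvec_add_smul_cvec]
    ext i
    simp [imvec, cvec]
  have h1 : ∀ η : ℝ, 0 < η → (star (G (cvec x + (Complex.I * η) • cvec u)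
      (cvec y + (Complex.I * η) • cvec u)) * linDiff (cvec w) G
      (cvec x + (Complex.I * η) • cvec u) (cvec y + (Complex.I * η) • cvec u)).im ≤ 0 := by
    intro η hη
    have hc : Continuous fun ε : ℝ => (cvec x + (Complex.I * η) • cvec (u + ε • e),
        cvec y + (Complex.I * η) • cvec (u + ε • e)) := by
      have : Continuous fun ε : ℝ => cvec (u + ε • e) := continuous_cvec.comp (by fun_prop)
      fun_prop
    have := le_of_forall_pos_of_continuous (hcont.comp hc) fun ε hε => by
      refine hG.wronskian_upper hf hw hwa ?_ ?_
      · rw [him]; exact hf.openCone_smul (hu ε hε) hη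
      · rw [him]; exact hf.openCone_smul (hu ε hε) hη
    simpa using this
  set α := realRestrict G x y
  set β := linDiff u (realRestrict G) x y with hβ
  set γ := mixDiff u (realRestrict G) x y with hγ
  set κ₀ := linDiff w (realRestrict G) x y with hκ₀
  set κ₁ := linDiff u (linDiff w (realRestrict G)) x y with hκ₁
  set κ₂ := mixDiff u (linDiff w (realRestrict G)) x y with hκ₂
  have e0 : G (cvec x) (cvec y) = (α : ℂ) := hG.eq_realRestrict x y
  have e1 : linDiff (cvec u) G (cvec x) (cvec y) = (β : ℂ) := by
    rw [hβ]; simp only [linDiff, ← cvec_add, hG.eq_realRestrict]; push_cast; rfl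
  have e2 : mixDiff (cvec u) G (cvec x) (cvec y) = (γ : ℂ) := by
    rw [hγ]; simp only [mixDiff, ← cvec_add, hG.eq_realRestrict]; push_cast; rfl
  have e3 : linDiff (cvec w) G (cvec x) (cvec y) = (κ₀ : ℂ) := by
    rw [hκ₀]; simp only [linDiff, ← cvec_add, hG.eq_realRestrict]; push_cast; rfl
  have e4 : linDiff (cvec u) (linDiff (cvec w) G) (cvec x) (cvec y) = (κ₁ : ℂ) := by
    rw [hκ₁]; simp only [linDiff, ← cvec_add, hG.eq_realRestrict]; push_cast; rfl
  have e5 : mixDiff (cvec u) (linDiff (cvec w) G) (cvec x) (cvec y) = (κ₂ : ℂ) := by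
    rw [hκ₂]; simp only [mixDiff, linDiff, ← cvec_add, hG.eq_realRestrict]; push_cast; rfl
  have h2 : ∀ η : ℝ, 0 < η → α * κ₁ - β * κ₀ + η ^ 2 * (β * κ₂ - γ * κ₁) ≤ 0 := by
    intro η hη
    have := h1 η hη
    rw [hua.diag, (hua.linDiff_affine (cvec w)).diag, e0, e1, e2, e3, e4, e5] at this
    have hI : (Complex.I * (η : ℂ)) ^ 2 = ((-(η ^ 2) : ℝ) : ℂ) := by
      rw [mul_pow, Complex.I_sq]; push_cast; ring
    rw [hI] at this
    simp [Complex.mul_im, Complex.mul_re, -Complex.ofReal_pow] at this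
    by_contra hcon
    push Not at hcon
    have := mul_pos hη hcon
    nlinarith
  have := le_of_forall_pos_of_continuous
    (φ := fun η => α * κ₁ - β * κ₀ + η ^ 2 * (β * κ₂ - γ * κ₁)) (by fun_prop) h2
  linarith

end StablePair

/-- At every point above `(M, M)`, `G` is positive and its logarithmic differences along `u j` are
bounded by `δ j`. -/
def BarrierBound {m n : ℕ} (f : (Fin m → ℂ) → ℂ) (e : Fin m → ℝ) (u : Fin n → Fin m → ℝ)
    (δ : Fin n → ℝ) (g : (Fin m → ℝ) → (Fin m → ℝ) → ℝ) (M : Fin m → ℝ) : Prop :=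
  ∀ c ∈ closedCone f e, 0 < g (M + c) (M + c) ∧
    ∀ j, linDiff (u j) g (M + c) (M + c) ≤ δ j * g (M + c) (M + c)

lemma StablePair.barrierBound_step {m n d D : ℕ} {f : (Fin m → ℂ) → ℂ} {e : Fin m → ℝ}
    {v : Fin n → Fin m → ℝ} {c : ℂ} {G : (Fin m → ℂ) → (Fin m → ℂ) → ℂ}
    (hG : StablePair f e v D c G) (hf : HyperbolicFun f d e) (hv : ∀ j, v j ∈ closedCone f e)
    {τ δ : Fin n → ℝ} (hτ : ∀ j, 0 ≤ τ j) (hδ : ∀ j, 0 ≤ δ j) {M : Fin m → ℝ}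
    (h : BarrierBound f e (fun j => τ j • v j) δ (realRestrict G) M) (i : Fin n) :
    BarrierBound f e (fun j => τ j • v j) δ
      (fun x y => realRestrict G x y - mixDiff (τ i • v i) (realRestrict G) x y)
      (M + δ i • τ i • v i) := by
  have hu : ∀ j, τ j • v j ∈ closedCone f e := fun j => hf.closed_smul (hv j) (hτ j)
  have hua : ∀ j, AffineAlong (R := ℂ) (cvec (τ j • v j)) G := fun j => by
    rw [cvec_smul]; exact (hG.aff j).smul _
  have hra : ∀ j, AffineAlong (R := ℝ) (τ j • v j) (realRestrict G) := fun j =>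
    hG.affineAlong_realRestrict (hua j)
  intro b hb
  have key : ∀ j, _ := fun j => barrier_shift (realRestrict G (M + b) (M + b))
    (linDiff (τ i • v i) (realRestrict G) (M + b) (M + b))
    (mixDiff (τ i • v i) (realRestrict G) (M + b) (M + b))
    (linDiff (τ j • v j) (realRestrict G) (M + b) (M + b))
    (linDiff (τ i • v i) (linDiff (τ j • v j) (realRestrict G)) (M + b) (M + b))
    (mixDiff (τ i • v i) (linDiff (τ j • v j) (realRestrict G)) (M + b) (M + b))
    (δ i) (δ j) (h b hb).1 (fun t ht => by
      have := (h _ (hf.closed_add hb (hf.closed_smul (hu i) ht))).1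
      rwa [← add_assoc, (hra i).diag] at this) ((h b hb).2 i) ((h b hb).2 j) (hδ i)
    (fun t => by
      have := hG.wronskian hf (hu i) (hu j) (hua i) (hua j) (M + b + t • τ i • v i)
        (M + b + t • τ i • v i)
      rwa [(hra i).diag, (hra i).linDiff_diag, ((hra i).linDiff_affine _).linDiff_diag,
        ((hra i).linDiff_affine _).diag] at this)
    (fun t => by
      have := hG.wronskian hf (hu i) (hu i) (hua i) (hua i) (M + b + t • τ i • v i)
        (M + b + t • τ i • v i)
      rwa [(hra i).diag, (hra i).linDiff_linDiff, (hra i).mixDiff_shift,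
        (hra i).linDiff_diag] at this)
  have hX : M + δ i • τ i • v i + b = M + b + δ i • τ i • v i := by abel
  have hg : realRestrict G (M + b + δ i • τ i • v i) (M + b + δ i • τ i • v i)
      - mixDiff (τ i • v i) (realRestrict G) (M + b + δ i • τ i • v i) (M + b + δ i • τ i • v i)
      = realRestrict G (M + b) (M + b) + linDiff (τ i • v i) (realRestrict G) (M + b) (M + b) * δ i
        + mixDiff (τ i • v i) (realRestrict G) (M + b) (M + b) * δ i ^ 2
        - mixDiff (τ i • v i) (realRestrict G) (M + b) (M + b) := by
    rw [(hra i).diag, (hra i).mixDiff_shift]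
  refine ⟨?_, fun j => ?_⟩
  · simp only [hX]
    rw [hg]
    exact (key i).1
  · simp only [hX]
    have hsub : ∀ X, linDiff (τ j • v j)
        (fun x y => realRestrict G x y - mixDiff (τ i • v i) (realRestrict G) x y) X X
        = linDiff (τ j • v j) (realRestrict G) X X
          - mixDiff (τ i • v i) (linDiff (τ j • v j) (realRestrict G)) X X := by
      intro X
      rw [← linDiff_mixDiff_comm]
      simp only [linDiff]
      ring
    rw [hg, hsub, ((hra i).linDiff_affine _).diag, ((hra i).linDiff_affine _).mixDiff_shift]
    exact (key j).2

/-! ### Choosing the values one at a time -/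

namespace StablePair

variable {m n d D : ℕ} {f : (Fin m → ℂ) → ℂ} {e : Fin m → ℝ} {v : Fin n → Fin m → ℝ} {c : ℂ}
  {G : (Fin m → ℂ) → (Fin m → ℂ) → ℂ}

lemma ne_zero_of_im_ne_zero (hG : StablePair f e v D c G) (hf : HyperbolicFun f d e)
    (A B : Fin m → ℝ) {s : ℂ} (hs : s.im ≠ 0) :
    G (s • cvec e + cvec A) (s • cvec e + cvec B) ≠ 0 := by
  have him : ∀ (s : ℂ) (A : Fin m → ℝ), imvec (s • cvec e + cvec A) = s.im • e := by
    intro s A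
    rw [add_comm, imvec_add_smul_cvec]
    ext i
    simp [imvec, cvec]
  have up : ∀ s : ℂ, 0 < s.im → G (s • cvec e + cvec A) (s • cvec e + cvec B) ≠ 0 := by
    intro s hs
    apply hG.stable
    · rw [him]; exact hf.openCone_smul hf.e_mem hs
    · rw [him]; exact hf.openCone_smul hf.e_mem hs
  rcases lt_or_gt_of_ne hs with h | h
  · intro h0
    apply up (star s) (by simpa using h)
    have hstar : ∀ A : Fin m → ℝ, star s • cvec e + cvec A = star (s • cvec e + cvec A) := by
      intro A
      rw [star_add, star_smul, star_cvec, star_cvec]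
    rw [hstar, hstar, hG.star_map, h0, star_zero]
  · exact up s h

lemma eventually_near (hG : StablePair f e v D c G) (hc : c ≠ 0) (A B : Fin m → ℝ) :
    ∃ R : ℝ, ∀ x : ℂ, R < ‖x‖ →
      ‖G (x • cvec e + cvec A) (x • cvec e + cvec B) / x ^ D - c‖ < ‖c‖ := by
  have := (hG.growth (cvec A) (cvec B)).eventually
    (Metric.ball_mem_nhds c (norm_pos_iff.mpr hc))
  obtain ⟨R, -, hR⟩ := (Metric.hasBasis_cobounded_compl_closedBall (0 : ℂ)).eventually_iff.mp this
  refine ⟨R, fun x hx => ?_⟩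
  have := hR (x := x) (by simpa using hx)
  simpa [dist_eq_norm] using this

lemma continuous_realRestrict (hG : StablePair f e v D c G) :
    Continuous fun z : (Fin m → ℝ) × (Fin m → ℝ) => realRestrict G z.1 z.2 :=
  Complex.continuous_re.comp (hG.cont.comp ((continuous_cvec.comp continuous_fst).prodMk
    (continuous_cvec.comp continuous_snd)))

/-- If an average is positive beyond `ρ` along `e`, then so is one of its terms. -/
lemma exists_pos_of_avgStep (hG : StablePair f e v D c G) (hf : HyperbolicFun f d e) (hc : c ≠ 0)
    {i : Fin n} (hv : v i ∈ closedCone f e) {S : Finset ℝ} {p : ℝ → ℝ} (hp : ∀ a ∈ S, 0 ≤ p a)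
    (hp1 : ∑ a ∈ S, p a = 1) (μ ρ : ℝ) (w : Fin m → ℝ)
    (hpos : ∀ x, ρ ≤ x →
      0 < realRestrict (_root_.avgStep S p μ (v i) G) (x • e + w) (x • e - w)) :
    ∃ a ∈ S, ∀ x, ρ ≤ x →
      0 < realRestrict G (x • e + (w + (a - μ) • v i)) (x • e - (w + (a - μ) • v i)) := by
  have hsum : ∀ x : ℝ, realRestrict (_root_.avgStep S p μ (v i) G) (x • e + w) (x • e - w)
      = ∑ a ∈ S, p a *
        realRestrict G (x • e + (w + (a - μ) • v i)) (x • e - (w + (a - μ) • v i)) := by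
    intro x
    rw [realRestrict, _root_.avgStep, Complex.re_sum]
    refine Finset.sum_congr rfl fun a _ => ?_
    rw [Complex.re_ofReal_mul, ← cvec_smul, ← cvec_add, ← cvec_sub, realRestrict, add_assoc,
      sub_sub]
  obtain ⟨a, ha, hap⟩ : ∃ a ∈ S,
      0 < realRestrict G (ρ • e + (w + (a - μ) • v i)) (ρ • e - (w + (a - μ) • v i)) := by
    by_contra hcon
    push Not at hcon
    have h1 := hpos ρ le_rfl
    rw [hsum] at h1
    exact absurd h1 (not_lt.mpr (Finset.sum_nonpos fun a ha =>
      mul_nonpos_of_nonneg_of_nonpos (hp a ha) (hcon a ha)))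
  refine ⟨a, ha, ?_⟩
  have hA := hG.avgStep hf hv hp hp1 μ
  set w' := w + (a - μ) • v i with hw'
  set Q : ℂ → ℂ := fun x => _root_.avgStep S p μ (v i) G (x • cvec e + cvec w)
    (x • cvec e + cvec (-w)) with hQ
  set P : ℂ → ℂ := fun x => G (x • cvec e + cvec w') (x • cvec e + cvec (-w')) with hP
  have hQr : ∀ x : ℝ, Q x
      = (realRestrict (_root_.avgStep S p μ (v i) G) (x • e + w) (x • e - w) : ℂ) := by
    intro x
    rw [← hA.eq_realRestrict, sub_eq_add_neg, cvec_add (x • e) w, cvec_add (x • e) (-w), cvec_smul]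
  have hPr : ∀ x : ℝ, P x = (realRestrict G (x • e + w') (x • e - w') : ℂ) := by
    intro x
    rw [← hG.eq_realRestrict, sub_eq_add_neg, cvec_add (x • e) w', cvec_add (x • e) (-w'), cvec_smul]
  have hmix : ∀ r ∈ Set.Icc (0 : ℝ) 1, ∀ x : ℂ, x.im ≠ 0 → (1 - (r : ℂ)) * Q x + r * P x ≠ 0 := by
    intro r hr x hx
    have hB := hG.avgStep hf hv (p := fun b => (1 - r) * p b + if b = a then r else 0)
      (fun b hb => by
        have h1 := mul_nonneg (sub_nonneg.mpr hr.2) (hp b hb)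
        have h2 : 0 ≤ if b = a then r else 0 := by split_ifs <;> simp [hr.1]
        exact add_nonneg h1 h2)
      (by rw [Finset.sum_add_distrib, ← Finset.mul_sum, hp1, Finset.sum_ite_eq' S a, if_pos ha]
          ring) μ
    have h3 := hB.ne_zero_of_im_ne_zero hf w (-w) hx
    convert h3 using 1
    have hterm : P x = G (x • cvec e + cvec w + ((a - μ : ℝ) : ℂ) • cvec (v i))
        (x • cvec e + cvec (-w) - ((a - μ : ℝ) : ℂ) • cvec (v i)) := by
      simp only [hP, hw']
      rw [neg_add, cvec_add, cvec_add, cvec_neg ((a - μ) • v i), cvec_smul, add_assoc,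
        add_sub_assoc, ← sub_eq_add_neg]
    have hsplit : ∀ b ∈ S, (((1 - r) * p b + if b = a then r else 0 : ℝ) : ℂ)
        * G (x • cvec e + cvec w + ((b - μ : ℝ) : ℂ) • cvec (v i))
          (x • cvec e + cvec (-w) - ((b - μ : ℝ) : ℂ) • cvec (v i))
        = (1 - (r : ℂ)) * ((p b : ℂ)
          * G (x • cvec e + cvec w + ((b - μ : ℝ) : ℂ) • cvec (v i))
            (x • cvec e + cvec (-w) - ((b - μ : ℝ) : ℂ) • cvec (v i)))
          + if b = a then r * P x else 0 := by
      intro b _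
      split_ifs with hba
      · subst hba
        rw [hterm]
        push_cast
        ring
      · push_cast
        ring
    rw [_root_.avgStep, Finset.sum_congr rfl hsplit, Finset.sum_add_distrib, ← Finset.mul_sum,
      Finset.sum_ite_eq' S a, if_pos ha]
    rfl
  have hQc : Continuous Q := hA.cont.comp (by fun_prop : Continuous fun x : ℂ =>
    (x • cvec e + cvec w, x • cvec e + cvec (-w)))
  have hPc : Continuous P := hG.cont.comp (by fun_prop : Continuous fun x : ℂ =>
    (x • cvec e + cvec w', x • cvec e + cvec (-w')))
  obtain ⟨R₁, hR₁⟩ := hA.eventually_near hc w (-w)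
  obtain ⟨R₂, hR₂⟩ := hG.eventually_near hc w' (-w')
  have hre : ∀ s : ℂ, ((ρ : ℂ) - Complex.I * s).im = -s.re := by
    intro s; simp
  have path := upper_zero_free_of_path
    (fun r s => (1 - (r : ℂ)) * Q (ρ - Complex.I * s) + r * P (ρ - Complex.I * s))
    (by fun_prop) ?_ (max (max R₁ R₂) 0 + |ρ|) ?_ ?_ ?_
  · have hne : ∀ x, ρ ≤ x → realRestrict G (x • e + w') (x • e - w') ≠ 0 := by
      intro x hx h0
      apply path (((x - ρ : ℝ) : ℂ) * Complex.I) (by simpa using hx)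
      have hx' : (ρ : ℂ) - Complex.I * (((x - ρ : ℝ) : ℂ) * Complex.I) = (x : ℂ) := by
        push_cast
        linear_combination -((x : ℂ) - ρ) * Complex.I_sq
      rw [hx', hPr, h0]
      simp
    intro x hx
    by_contra hcon
    push Not at hcon
    have hcont : Continuous fun x : ℝ => realRestrict G (x • e + w') (x • e - w') :=
      hG.continuous_realRestrict.comp (by fun_prop : Continuous fun x : ℝ =>
        (x • e + w', x • e - w'))
    obtain ⟨y, hy, hy0⟩ := intermediate_value_Icc' hx hcont.continuousOn
      (show (0 : ℝ) ∈ Set.Icc _ _ from ⟨hcon, hap.le⟩)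
    exact hne y hy.1 hy0
  · intro r
    obtain ⟨q₁, hq₁⟩ := hA.line ((ρ : ℂ) • cvec e + cvec w) ((-Complex.I) • cvec e)
      ((ρ : ℂ) • cvec e + cvec (-w)) ((-Complex.I) • cvec e)
    obtain ⟨q₂, hq₂⟩ := hG.line ((ρ : ℂ) • cvec e + cvec w') ((-Complex.I) • cvec e)
      ((ρ : ℂ) • cvec e + cvec (-w')) ((-Complex.I) • cvec e)
    refine ⟨Polynomial.C (1 - (r : ℂ)) * q₁ + Polynomial.C (r : ℂ) * q₂, fun s => ?_⟩
    have hv' : ∀ A : Fin m → ℂ, ((ρ : ℂ) - Complex.I * s) • cvec e + A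
        = (ρ : ℂ) • cvec e + A + s • (-Complex.I) • cvec e := fun A => by module
    rw [Polynomial.eval_add, Polynomial.eval_mul, Polynomial.eval_mul, Polynomial.eval_C,
      Polynomial.eval_C, ← hq₁, ← hq₂]
    simp only [hQ, hP, hv']
  · intro r hr s hs
    by_contra hcon
    push Not at hcon
    set x := (ρ : ℂ) - Complex.I * s with hx
    have hxs : ‖s‖ - |ρ| ≤ ‖x‖ := by
      have h1 : ‖Complex.I * s‖ = ‖s‖ := by simp
      have h2 := norm_sub_norm_le (Complex.I * s) (ρ : ℂ)
      rw [h1, Complex.norm_real, Real.norm_eq_abs, norm_sub_rev] at h2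
      exact h2
    have hxR : max (max R₁ R₂) 0 < ‖x‖ := by linarith
    have hx0 : x ≠ 0 := norm_pos_iff.mp (lt_of_le_of_lt (le_max_right _ _) hxR)
    have b1 := hR₁ x (lt_of_le_of_lt ((le_max_left _ _).trans (le_max_left _ _)) hxR)
    have b2 := hR₂ x (lt_of_le_of_lt ((le_max_right _ _).trans (le_max_left _ _)) hxR)
    have hcomb : (1 - (r : ℂ)) * (Q x / x ^ D - c) + r * (P x / x ^ D - c) = -c := by
      have : (1 - (r : ℂ)) * (Q x / x ^ D - c) + r * (P x / x ^ D - c)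
          = ((1 - (r : ℂ)) * Q x + r * P x) / x ^ D - c := by ring
      rw [this, hs]
      simp
    have hn := norm_add_le ((1 - (r : ℂ)) * (Q x / x ^ D - c)) (r * (P x / x ^ D - c))
    have hr1 : ‖(1 - (r : ℂ))‖ = 1 - r := by
      rw [← Complex.ofReal_one, ← Complex.ofReal_sub, Complex.norm_real, Real.norm_eq_abs,
        abs_of_nonneg (sub_nonneg.mpr hr.2)]
    have hr2 : ‖(r : ℂ)‖ = r := by
      rw [Complex.norm_real, Real.norm_eq_abs, abs_of_nonneg hr.1]
    rw [hcomb, norm_neg, norm_mul, norm_mul, hr1, hr2] at hn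
    rcases hr.1.eq_or_lt with h | h
    · rw [← h] at hn
      change ‖Q x / x ^ D - c‖ < ‖c‖ at b1
      linarith
    · have h3 := mul_lt_mul_of_pos_left b2 h
      have h4 := mul_le_mul_of_nonneg_left b1.le (sub_nonneg.mpr hr.2)
      change (1 - r) * ‖Q x / x ^ D - c‖ ≤ _ at h4
      change r * ‖P x / x ^ D - c‖ < _ at h3
      linarith
  · intro r hr x
    rcases eq_or_ne x 0 with hx | hx
    · subst hx
      have h1 := hpos ρ le_rfl
      simp only [Complex.ofReal_zero, mul_zero, sub_zero]
      rw [hQr, hPr]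
      norm_cast
      have h2 := mul_nonneg (sub_nonneg.mpr hr.2) h1.le
      rcases hr.1.eq_or_lt with h | h
      · rw [← h]
        simpa using h1.ne'
      · have := mul_pos h hap
        linarith
    · exact hmix r hr _ (by rw [hre]; simpa using hx)
  · intro s hs
    by_cases hs0 : s.re = 0
    · have hse : (ρ : ℂ) - Complex.I * s = ((ρ + s.im : ℝ) : ℂ) := by
        apply Complex.ext <;> simp [hs0]
      rw [hse, hQr]
      have := (hpos (ρ + s.im) (by linarith)).ne'
      simpa using this
    · have := hmix 0 ⟨le_rfl, zero_le_one⟩ _ (by rw [hre]; simpa using hs0)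
      exact this

end StablePair

/-! ### Averaging over all variables -/

/-- The average of `f (M + ∑ (aᵢ - μᵢ) vᵢ) f (N - ∑ (aᵢ - μᵢ) vᵢ)` over the indices in a list. -/
def avgList {m n : ℕ} (f : (Fin m → ℂ) → ℂ) (v : Fin n → Fin m → ℝ) (S : Fin n → Finset ℝ)
    (p : Fin n → ℝ → ℝ) (μ : Fin n → ℝ) : List (Fin n) → (Fin m → ℂ) → (Fin m → ℂ) → ℂ
  | [] => fun M N => f M * f N
  | i :: l => avgStep (S i) (p i) (μ i) (v i) (avgList f v S p μ l)

section AvgList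

variable {m n d : ℕ} {f : (Fin m → ℂ) → ℂ} {e : Fin m → ℝ} {v : Fin n → Fin m → ℝ}
  {S : Fin n → Finset ℝ} {p : Fin n → ℝ → ℝ}

lemma stablePair_avgList (hf : HyperbolicFun f d e)
    (haff : ∀ j Z (t : ℂ), f (Z + t • cvec (v j)) = f Z + t * (f (Z + cvec (v j)) - f Z))
    (hv : ∀ j, v j ∈ closedCone f e) (hp : ∀ i, ∀ a ∈ S i, 0 ≤ p i a)
    (hp1 : ∀ i, ∑ a ∈ S i, p i a = 1) (μ : Fin n → ℝ) (l : List (Fin n)) :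
    StablePair f e v (d + d) (f (cvec e) * f (cvec e)) (avgList f v S p μ l) := by
  induction l with
  | nil => exact StablePair.of_hyperbolic hf haff
  | cons i l ih => exact ih.avgStep hf (hv i) (hp i) (hp1 i) (μ i)

lemma barrierBound_avgList (hf : HyperbolicFun f d e)
    (haff : ∀ j Z (t : ℂ), f (Z + t • cvec (v j)) = f Z + t * (f (Z + cvec (v j)) - f Z))
    (hv : ∀ j, v j ∈ closedCone f e) (hp : ∀ i, ∀ a ∈ S i, 0 ≤ p i a)
    (hp1 : ∀ i, ∑ a ∈ S i, p i a = 1) {μ τ δ : Fin n → ℝ}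
    (hμ : ∀ i, μ i = ∑ a ∈ S i, p i a * a) (hτ0 : ∀ i, 0 ≤ τ i)
    (hτ : ∀ i, τ i ^ 2 = ∑ a ∈ S i, p i a * (a - μ i) ^ 2) (hδ : ∀ i, 0 ≤ δ i) {M : Fin m → ℝ}
    (hM : BarrierBound f e (fun j => τ j • v j) δ (realRestrict fun M N => f M * f N) M)
    (l : List (Fin n)) :
    BarrierBound f e (fun j => τ j • v j) δ (realRestrict (avgList f v S p μ l))
      (M + (l.map fun i => δ i • τ i • v i).sum) := by
  induction l with
  | nil => simpa [avgList] using hM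
  | cons i l ih =>
    have hG := stablePair_avgList hf haff hv hp hp1 μ l
    have := hG.barrierBound_step hf hv hτ0 hδ ih i
    have heq : realRestrict (avgList f v S p μ (i :: l))
        = fun x y => realRestrict (avgList f v S p μ l) x y
          - mixDiff (τ i • v i) (realRestrict (avgList f v S p μ l)) x y := by
      ext x y
      rw [realRestrict, avgList, (hG.aff i).avgStep_centered (hp1 i) (hμ i) (hτ i)]
      simp only [mixDiff, ← cvec_add, realRestrict, Complex.sub_re, Complex.add_re]
    rw [heq, List.map_cons, List.sum_cons, add_comm (δ i • τ i • v i), ← add_assoc]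
    exact this

lemma exists_assignment_of_avgList (hf : HyperbolicFun f d e)
    (haff : ∀ j Z (t : ℂ), f (Z + t • cvec (v j)) = f Z + t * (f (Z + cvec (v j)) - f Z))
    (hv : ∀ j, v j ∈ closedCone f e) (hS : ∀ i, (S i).Nonempty)
    (hp : ∀ i, ∀ a ∈ S i, 0 ≤ p i a) (hp1 : ∀ i, ∑ a ∈ S i, p i a = 1) (μ : Fin n → ℝ) (ρ : ℝ)
    (l : List (Fin n)) (hl : l.Nodup) (w : Fin m → ℝ)
    (hpos : ∀ x, ρ ≤ x → 0 < realRestrict (avgList f v S p μ l) (x • e + w) (x • e - w)) :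
    ∃ s : Fin n → ℝ, (∀ i, s i ∈ S i) ∧ ∀ x, ρ ≤ x → 0 < realRestrict (fun M N => f M * f N)
      (x • e + (w + (l.map fun i => (s i - μ i) • v i).sum))
      (x • e - (w + (l.map fun i => (s i - μ i) • v i).sum)) := by
  induction l generalizing w with
  | nil =>
    choose s hs using hS
    exact ⟨s, hs, by simpa [avgList] using hpos⟩
  | cons i l ih =>
    rw [List.nodup_cons] at hl
    have hG := stablePair_avgList hf haff hv hp hp1 μ l
    obtain ⟨a, ha, hapos⟩ := hG.exists_pos_of_avgStep hf
      (mul_ne_zero hf.ne_zero hf.ne_zero) (hv i) (hp i) (hp1 i) (μ i) ρ w hpos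
    obtain ⟨s, hs, hspos⟩ := ih hl.2 _ hapos
    refine ⟨Function.update s i a, fun j => ?_, fun x hx => ?_⟩
    · rcases eq_or_ne j i with rfl | hj
      · simpa using ha
      · simpa [hj] using hs j
    · have hmap : (l.map fun j => (Function.update s i a j - μ j) • v j)
          = l.map fun j => (s j - μ j) • v j := by
        refine List.map_congr_left fun j hj => ?_
        have hji : j ≠ i := by
          rintro rfl
          exact hl.1 hj
        rw [Function.update_of_ne hji]
      rw [List.map_cons, List.sum_cons, hmap, Function.update_self, ← add_assoc w]
      exact hspos x hx

/-- If the barrier bound holds below `x e` for every `x ≥ ρ`, some assignment keeps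
`x ↦ f (x e + W) f (x e - W)` positive beyond `ρ`. -/
lemma exists_assignment (hf : HyperbolicFun f d e)
    (haff : ∀ j Z (t : ℂ), f (Z + t • cvec (v j)) = f Z + t * (f (Z + cvec (v j)) - f Z))
    (hv : ∀ j, v j ∈ closedCone f e) (hS : ∀ i, (S i).Nonempty)
    (hp : ∀ i, ∀ a ∈ S i, 0 ≤ p i a) (hp1 : ∀ i, ∑ a ∈ S i, p i a = 1) {μ τ : Fin n → ℝ}
    (hμ : ∀ i, μ i = ∑ a ∈ S i, p i a * a) (hτ0 : ∀ i, 0 ≤ τ i)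
    (hτ : ∀ i, τ i ^ 2 = ∑ a ∈ S i, p i a * (a - μ i) ^ 2) (ρ : ℝ) (δ : ℝ → Fin n → ℝ)
    (hδ : ∀ x, ρ ≤ x → ∀ i, 0 ≤ δ x i)
    (hM : ∀ x, ρ ≤ x → BarrierBound f e (fun j => τ j • v j) (δ x)
      (realRestrict fun M N => f M * f N) (x • e - ∑ i, δ x i • τ i • v i)) :
    ∃ s : Fin n → ℝ, (∀ i, s i ∈ S i) ∧ ∀ x, ρ ≤ x →
      f (cvec (x • e + ∑ i, (s i - μ i) • v i)) ≠ 0 ∧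
        f (cvec (x • e - ∑ i, (s i - μ i) • v i)) ≠ 0 := by
  obtain ⟨s, hs, h⟩ := exists_assignment_of_avgList hf haff hv hS hp hp1 μ ρ
    (List.finRange n) (List.nodup_finRange n) 0 fun x hx => by
      have := barrierBound_avgList hf haff hv hp hp1 hμ hτ0 hτ (hδ x hx) (hM x hx) (List.finRange n)
      have := (this 0 (by simpa using hf.closed_smul (HyperbolicFun.openCone_subset_closedCone hf.e_mem) le_rfl)).1
      rw [← Fin.sum_univ_def] at this
      simpa using this
  refine ⟨s, hs, fun x hx => ?_⟩
  have h1 := h x hx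
  rw [← Fin.sum_univ_def, zero_add, realRestrict] at h1
  constructor <;> intro h0 <;> rw [h0] at h1 <;> simp at h1

end AvgList

/-! ### The complexification of a hyperbolic polynomial -/

/-- The complexification of a real polynomial, as a function. -/
def complexEval {m : ℕ} (h : MvPolynomial (Fin m) ℝ) (Z : Fin m → ℂ) : ℂ := aeval Z h

lemma complexEval_cvec {m : ℕ} (h : MvPolynomial (Fin m) ℝ) (x : Fin m → ℝ) :
    complexEval h (cvec x) = (eval x h : ℂ) := by
  have := aeval_algebraMap_apply ℂ x h
  exact this

lemma complexEval_line {m : ℕ} (h : MvPolynomial (Fin m) ℝ) (Z W : Fin m → ℂ) :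
    ∃ p : Polynomial ℂ, ∀ s : ℂ, complexEval h (Z + s • W) = p.eval s := by
  refine ⟨aeval (fun i => Polynomial.C (Z i) + Polynomial.X * Polynomial.C (W i)) h, fun s => ?_⟩
  unfold complexEval
  induction h using MvPolynomial.induction_on with
  | C a =>
    simp only [aeval_C]
    rw [Polynomial.algebraMap_apply, Polynomial.eval_C]
  | add p q hp hq => simp only [map_add, hp, hq, Polynomial.eval_add]
  | mul_X p i hp =>
    simp only [map_mul, hp, aeval_X, Polynomial.eval_mul, Polynomial.eval_add, Polynomial.eval_C,
      Polynomial.eval_X, Pi.add_apply, Pi.smul_apply, smul_eq_mul]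

lemma complexEval_star {m : ℕ} (h : MvPolynomial (Fin m) ℝ) (Z : Fin m → ℂ) :
    complexEval h (star Z) = star (complexEval h Z) := by
  unfold complexEval
  induction h using MvPolynomial.induction_on with
  | C a => simp
  | add p q hp hq => simp only [map_add, hp, hq, star_add]
  | mul_X p i hp => simp only [map_mul, hp, aeval_X, star_mul', Pi.star_apply]

lemma continuous_complexEval {m : ℕ} (h : MvPolynomial (Fin m) ℝ) :
    Continuous (complexEval h) := by
  have : complexEval h = fun Z => eval Z (map (algebraMap ℝ ℂ) h) := by
    ext Z
    rw [eval_map]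
    rfl
  rw [this]
  exact MvPolynomial.continuous_eval _

lemma complexEval_smul {m d : ℕ} {h : MvPolynomial (Fin m) ℝ} (hh : h.IsHomogeneous d) (s : ℂ)
    (Z : Fin m → ℂ) : complexEval h (s • Z) = s ^ d * complexEval h Z := by
  unfold complexEval
  rw [aeval_def, aeval_def, eval₂_eq, eval₂_eq, Finset.mul_sum]
  refine Finset.sum_congr rfl fun b hb => ?_
  have hdeg : ∑ i ∈ b.support, b i = d := by
    have := hh (mem_support_iff.mp hb)
    rw [← this, Finsupp.weight_apply, Finsupp.sum]
    simp
  simp only [Pi.smul_apply, smul_eq_mul, mul_pow]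
  rw [Finset.prod_mul_distrib, Finset.prod_pow_eq_pow_sum, hdeg]
  ring

namespace IsHyperbolic

variable {m d : ℕ} {h : MvPolynomial (Fin m) ℝ} {e : Fin m → ℝ}
  {lam : (Fin m → ℝ) → Fin d → ℝ}

lemma complexEval_add_smul (hh : IsHyperbolic h e lam) (x : Fin m → ℝ) (t : ℂ) :
    complexEval h (cvec x + t • cvec e) = eval e h * ∏ i, (t + lam x i) := by
  rw [← sub_eq_zero]
  refine eq_zero_of_eventually_real
    (fun t => complexEval h (cvec x + t • cvec e) - eval e h * ∏ i, (t + lam x i)) ?_ 0 ?_ t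
  · obtain ⟨p, hp⟩ := complexEval_line h (cvec x) (cvec e)
    refine ⟨p - Polynomial.C (eval e h : ℂ) * ∏ i, (Polynomial.X + Polynomial.C (lam x i : ℂ)),
      fun s => ?_⟩
    simp [hp, Polynomial.eval_prod]
  · intro t _
    have h1 := hh.2.2.2 x (-t)
    have h2 : cvec x + (t : ℂ) • cvec e = (-1 : ℂ) • cvec (-t • e - x) := by
      rw [cvec_sub, cvec_smul]
      push_cast
      module
    rw [h2, complexEval_smul hh.1, complexEval_cvec, h1]
    push_cast
    have h3 : ∀ i, (-(t : ℂ) - lam x i) = (-1) * (t + lam x i) := fun i => by ring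
    simp only [h3, Finset.prod_mul_distrib, Finset.prod_const, Finset.card_univ, Fintype.card_fin]
    have h4 : ((-1 : ℂ) ^ d) * (-1) ^ d = 1 := by rw [← mul_pow]; simp
    linear_combination (eval e h : ℂ) * (∏ i, ((t : ℂ) + lam x i)) * h4

lemma hyperbolicFun (hh : IsHyperbolic h e lam) : HyperbolicFun (complexEval h) d e where
  cont := continuous_complexEval h
  line := complexEval_line h
  homog := complexEval_smul hh.1
  star_map := complexEval_star h
  real_rooted A s hs := by
    rw [hh.complexEval_add_smul]
    refine mul_ne_zero (by exact_mod_cast hh.2.1.ne') (Finset.prod_ne_zero_iff.mpr fun i _ h0 => ?_)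
    have := congrArg Complex.im h0
    simp at this
    exact hs this
  pos := by
    rw [complexEval_cvec]
    exact_mod_cast hh.2.1

lemma mem_closedCone (hh : IsHyperbolic h e lam) {x : Fin m → ℝ} (hx : InCone lam x) :
    x ∈ closedCone (complexEval h) e := by
  intro t ht t' ht'
  have : cvec (x + t • e + t' • e) = cvec x + ((t + t' : ℝ) : ℂ) • cvec e := by
    rw [← cvec_smul, ← cvec_add, add_smul, add_assoc]
  rw [this, hh.complexEval_add_smul]
  norm_cast
  refine (mul_pos hh.2.1 (Finset.prod_pos fun i _ => ?_)).ne'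
  have := hx i
  linarith

lemma sub_mem_closedCone (hh : IsHyperbolic h e lam) (x : Fin m → ℝ) :
    hnorm lam x • e - x ∈ closedCone (complexEval h) e := by
  intro t ht t' ht'
  have : hnorm lam x • e - x + t • e + t' • e = (hnorm lam x + t + t') • e - x := by module
  rw [this, complexEval_cvec, hh.2.2.2]
  norm_cast
  refine (mul_pos hh.2.1 (Finset.prod_pos fun i _ => ?_)).ne'
  have h1 : |lam x i| ≤ hnorm lam x := le_ciSup (Set.finite_range fun i => |lam x i|).bddAbove i
  have h2 := le_abs_self (lam x i)
  linarith

lemma complexEval_rank_one (hh : IsHyperbolic h e lam) {v : Fin m → ℝ} (hr : hrank lam v ≤ 1)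
    {K : ℝ} (hK : 0 < K) (t : ℝ) : complexEval h (cvec (K • e + t • v))
      = ((eval e h * K ^ d * (1 + t * htrace lam v / K) : ℝ) : ℂ) := by
  have hprod : ∏ i, (K + t * lam v i) = K ^ d * (1 + t * htrace lam v / K) := by
    have h1 : ∀ i, K + t * lam v i = K * (1 + t * lam v i / K) := fun i => by
      field_simp
    simp only [h1, Finset.prod_mul_distrib, Finset.prod_const, Finset.card_univ, Fintype.card_fin]
    congr 1
    by_cases hz : ∃ i, lam v i ≠ 0
    · obtain ⟨i₀, hi₀⟩ := hz
      have hother : ∀ i, i ≠ i₀ → lam v i = 0 := by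
        intro i hi
        by_contra hc
        rw [hrank, Finite.card_le_one_iff_subsingleton] at hr
        exact hi (congrArg Subtype.val
          (Subsingleton.elim (⟨i, hc⟩ : {i : Fin d // lam v i ≠ 0}) ⟨i₀, hi₀⟩))
      rw [htrace, Finset.prod_eq_single i₀ (fun i _ hi => by simp [hother i hi]) (by simp),
        Finset.sum_eq_single i₀ (fun i _ hi => hother i hi) (by simp)]
    · push Not at hz
      simp [htrace, hz]
  rw [mul_assoc, ← hprod]
  rcases eq_or_ne t 0 with rfl | ht
  · rw [zero_smul, add_zero, cvec_smul, complexEval_smul hh.1, complexEval_cvec]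
    simp [mul_comm]
  · have h1 : cvec (K • e + t • v) = (t : ℂ) • (cvec v + ((K / t : ℝ) : ℂ) • cvec e) := by
      rw [← cvec_smul, ← cvec_add, ← cvec_smul, smul_add, smul_smul, mul_div_cancel₀ _ ht, add_comm]
    rw [h1, complexEval_smul hh.1, hh.complexEval_add_smul]
    norm_cast
    rw [mul_left_comm]
    congr 1
    have h2 : ∀ i, K + t * lam v i = t * (K / t + lam v i) := fun i => by
      field_simp
    simp only [h2, Finset.prod_mul_distrib, Finset.prod_const, Finset.card_univ, Fintype.card_fin]

lemma complexEval_affine (hh : IsHyperbolic h e lam) {v : Fin m → ℝ} (hv : InCone lam v)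
    (hr : hrank lam v ≤ 1) (Z : Fin m → ℂ) (t : ℂ) :
    complexEval h (Z + t • cvec v)
      = complexEval h Z + t * (complexEval h (Z + cvec v) - complexEval h Z) := by
  refine hh.hyperbolicFun.affine_along (hh.mem_closedCone hv) (fun K hK => ?_) Z t
  refine ⟨eval e h * K ^ d, eval e h * K ^ d * (htrace lam v / K), fun t ht => ?_⟩
  have htr : 0 ≤ htrace lam v := Finset.sum_nonneg fun i _ => hv i
  have := hh.2.1
  rw [hh.complexEval_rank_one hr hK, Complex.norm_real, Real.norm_eq_abs,
    abs_of_nonneg (by positivity)]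
  exact le_of_eq (by ring)

/-- The logarithmic difference along a rank-one vector of the cone is controlled by its trace. -/
lemma difference_le (hh : IsHyperbolic h e lam) {v : Fin m → ℝ} (hv : InCone lam v)
    (hr : hrank lam v ≤ 1) {κ : ℝ} (hκ : 0 < κ) {P : Fin m → ℝ}
    (hP : P - κ • e ∈ closedCone (complexEval h) e) :
    κ * (eval (P + v) h - eval P h) ≤ htrace lam v * eval P h := by
  have hf := hh.hyperbolicFun
  have htr : 0 ≤ htrace lam v := Finset.sum_nonneg fun i _ => hv i
  have hP0 : 0 < eval P h := by
    have h1 := hf.open_add_closed (hf.openCone_smul hf.e_mem hκ) hP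
    rw [add_sub_cancel] at h1
    simpa [complexEval_cvec] using hf.re_pos h1
  by_contra hcon
  push Not at hcon
  set D := eval (P + v) h - eval P h with hD
  have hD0 : 0 < D := by
    by_contra hc
    push Not at hc
    nlinarith [mul_nonneg htr hP0.le]
  set s := eval P h / D with hs
  have hs0 : 0 ≤ s := by positivity
  have hsT : s * htrace lam v < κ := by
    rw [hs, div_mul_eq_mul_div, div_lt_iff₀ hD0]
    linarith
  have hopen : κ • e + (-s) • v ∈ openCone (complexEval h) e := by
    intro t ht
    have h1 : κ • e + (-s) • v + t • e = (κ + t) • e + (-s) • v := by module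
    have hK : 0 < κ + t := by linarith
    rw [h1, hh.complexEval_rank_one hr hK]
    norm_cast
    have h2 : 0 < 1 + -s * htrace lam v / (κ + t) := by
      have : s * htrace lam v / (κ + t) < 1 := by
        rw [div_lt_one hK]
        linarith
      rw [neg_mul, neg_div]
      linarith
    have := hh.2.1
    positivity
  have h3 := HyperbolicFun.openCone_ne_zero (hf.open_add_closed hopen hP)
  apply h3
  have h4 : cvec (κ • e + (-s) • v + (P - κ • e)) = cvec P + ((-s : ℝ) : ℂ) • cvec v := by
    rw [← cvec_smul, ← cvec_add]
    congr 1
    module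
  rw [h4, hh.complexEval_affine hv hr, ← cvec_add, complexEval_cvec, complexEval_cvec]
  norm_cast
  rw [← hD, hs]
  field_simp
  ring

lemma barrierBound (hh : IsHyperbolic h e lam) {n : ℕ} {v : Fin n → Fin m → ℝ}
    (hv : ∀ i, InCone lam (v i)) (hr : ∀ i, hrank lam (v i) ≤ 1) {τ : Fin n → ℝ}
    (hτ0 : ∀ i, 0 ≤ τ i) {σ : ℝ} (hσ0 : 0 ≤ σ)
    (hσ : σ ^ 2 = hnorm lam (∑ i, (τ i ^ 2 * htrace lam (v i)) • v i)) {x : ℝ} (hx0 : 0 < x)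
    (hx : 4 * σ ≤ x) :
    BarrierBound (complexEval h) e (fun j => τ j • v j)
      (fun j => 4 / x * (τ j * htrace lam (v j)))
      (realRestrict fun M N => complexEval h M * complexEval h N)
      (x • e - ∑ i, (4 / x * (τ i * htrace lam (v i))) • τ i • v i) := by
  have hf := hh.hyperbolicFun
  set Y := ∑ i, (τ i ^ 2 * htrace lam (v i)) • v i with hY
  have hsum : ∑ i, (4 / x * (τ i * htrace lam (v i))) • τ i • v i = (4 / x) • Y := by
    rw [hY, Finset.smul_sum]
    refine Finset.sum_congr rfl fun i _ => ?_
    rw [smul_smul, smul_smul]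
    congr 1
    ring
  rw [hsum]
  intro b hb
  set P := x • e - (4 / x) • Y + b with hP
  have hPe : P - (x / 2) • e ∈ closedCone (complexEval h) e := by
    have h1 := hh.sub_mem_closedCone Y
    rw [← hσ] at h1
    have h2 : 0 ≤ x / 2 - 4 / x * σ ^ 2 := by
      have : 4 / x * σ ^ 2 = (4 * σ) ^ 2 / (4 * x) := by field_simp
      rw [this, sub_nonneg, div_le_iff₀ (by linarith)]
      nlinarith
    have h3 := hf.closed_add (hf.closed_add (hf.closed_smul h1 (by positivity : 0 ≤ 4 / x))
      (hf.closed_smul (HyperbolicFun.openCone_subset_closedCone hf.e_mem) h2)) hb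
    convert h3 using 1
    rw [hP]
    module
  have hPo : 0 < eval P h := by
    have h1 := hf.open_add_closed (hf.openCone_smul hf.e_mem (half_pos hx0)) hPe
    rw [add_sub_cancel] at h1
    simpa [complexEval_cvec] using hf.re_pos h1
  have hg : ∀ y z : Fin m → ℝ, realRestrict (fun M N => complexEval h M * complexEval h N) y z
      = eval y h * eval z h := by
    intro y z
    rw [realRestrict, complexEval_cvec, complexEval_cvec]
    norm_cast
  refine ⟨by rw [hg]; positivity, fun j => ?_⟩
  have hd := hh.difference_le (hv j) (hr j) (half_pos hx0) hPe
  have haff := hh.complexEval_affine (hv j) (hr j) (cvec P) (τ j : ℂ)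
  rw [← cvec_smul, ← cvec_add, ← cvec_add, complexEval_cvec, complexEval_cvec, complexEval_cvec]
    at haff
  norm_cast at haff
  rw [linDiff, hg, hg, hg, haff]
  have h5 : eval (P + v j) h - eval P h ≤ 2 / x * (htrace lam (v j) * eval P h) := by
    rw [div_mul_eq_mul_div, le_div_iff₀ hx0]
    linarith
  have h6 := mul_le_mul_of_nonneg_left h5 (mul_nonneg (mul_nonneg zero_le_two (hτ0 j)) hPo.le)
  have h7 : 2 * τ j * eval P h * (2 / x * (htrace lam (v j) * eval P h))
      = 4 / x * (τ j * htrace lam (v j)) * (eval P h * eval P h) := by ring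
  rw [h7] at h6
  linarith

end IsHyperbolic

theorem hyperbolic_four_deviations
    {m d n : ℕ} (h : MvPolynomial (Fin m) ℝ) (e : Fin m → ℝ)
    (lam : (Fin m → ℝ) → Fin d → ℝ)
    (hhyp : IsHyperbolic h e lam) (he : InOpenCone lam e)
    (S : Fin n → Finset ℝ) (p : Fin n → ℝ → ℝ)
    (hS : ∀ i, (S i).Nonempty)
    (hp : ∀ i, ∀ a ∈ S i, 0 < p i a)
    (hp1 : ∀ i, ∑ a ∈ S i, p i a = 1)
    (μ τ : Fin n → ℝ)
    (hμ : ∀ i, μ i = ∑ a ∈ S i, p i a * a)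
    (hτ0 : ∀ i, 0 ≤ τ i)
    (hτ : ∀ i, τ i ^ 2 = ∑ a ∈ S i, p i a * (a - μ i) ^ 2)
    (v : Fin n → Fin m → ℝ)
    (hv : ∀ i, InCone lam (v i))
    (hvrank : ∀ i, hrank lam (v i) ≤ 1)
    (σ : ℝ) (hσ0 : 0 ≤ σ)
    (hσ : σ ^ 2 = hnorm lam (∑ i, (τ i ^ 2 * htrace lam (v i)) • v i)) :
    ∃ s : Fin n → ℝ, (∀ i, s i ∈ S i) ∧
      hnorm lam (∑ i, (s i - μ i) • v i) ≤ 4 * σ := by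
  by_contra hcon
  push Not at hcon
  have hf := hhyp.hyperbolicFun
  obtain ⟨s₀, hs₀, hmin⟩ := Finset.exists_min_image (Fintype.piFinset S)
    (fun s => hnorm lam (∑ i, (s i - μ i) • v i)) (Fintype.piFinset_nonempty.mpr hS)
  rw [Fintype.mem_piFinset] at hs₀
  set ρ := hnorm lam (∑ i, (s₀ i - μ i) • v i) with hρ
  have hρσ : 4 * σ < ρ := hcon s₀ hs₀
  have hρ0 : 0 < ρ := by linarith
  obtain ⟨s, hs, hne⟩ := exists_assignment hf
    (fun j => hhyp.complexEval_affine (hv j) (hvrank j)) (fun j => hhyp.mem_closedCone (hv j)) hS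
    (fun i a ha => (hp i a ha).le) hp1 hμ hτ0 hτ ρ
    (fun x j => 4 / x * (τ j * htrace lam (v j)))
    (fun x hx i => mul_nonneg (div_nonneg zero_le_four (hρ0.le.trans hx))
      (mul_nonneg (hτ0 i) (Finset.sum_nonneg fun k _ => hv i k)))
    (fun x hx => hhyp.barrierBound hv hvrank hτ0 hσ0 hσ (hρ0.trans_le hx) (hρσ.le.trans hx))
  set W := ∑ i, (s i - μ i) • v i with hW
  have hle : ρ ≤ hnorm lam W := hmin s (Fintype.mem_piFinset.mpr hs)
  obtain ⟨hplus, hminus⟩ := hne _ hle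
  have hd : Nonempty (Fin d) := by
    by_contra hd
    rw [not_nonempty_iff] at hd
    have : hnorm lam W = 0 := by rw [hnorm, Real.iSup_of_isEmpty]
    linarith
  obtain ⟨i, hi⟩ := exists_eq_ciSup_of_finite (f := fun i => |lam W i|)
  change |lam W i| = hnorm lam W at hi
  rcases eq_or_eq_neg_of_abs_eq hi with h1 | h1
  · apply hminus
    rw [complexEval_cvec, hhyp.2.2.2, Finset.prod_eq_zero (Finset.mem_univ i) (by rw [h1, sub_self])]
    simp
  · apply hplus
    rw [add_comm, cvec_add, cvec_smul, hhyp.complexEval_add_smul,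
      Finset.prod_eq_zero (Finset.mem_univ i) (by rw [h1]; simp), mul_zero]
end
end

section
/- Let h ∈ ℝ[x₁,…,x_m] be hyperbolic with respect to e, let ξ be a real random variable with finite support, E[ξ] = 0 and Var[ξ] = τ², and let v ∈ ℝ^m with rank_h(v) ≤ 1. Then for any x₁, x₂ ∈ ℝ^m, E_ξ[ h(x₁ − ξv) · h(x₂ + ξv) ] = (1 − (1/2) d²/dt²)|_{t=0} [ h(x₁ + tτv) · h(x₂ + tτv) ]. -/
open MvPolynomial Finset
open scoped Classical

noncomputable section

/-- Scaling behaviour of homogeneous polynomials. -/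
theorem MvPolynomial.IsHomogeneous.eval_smul_eq {σ : Type*} {d : ℕ} {h : MvPolynomial σ ℝ}
    (hh : h.IsHomogeneous d) (c : ℝ) (x : σ → ℝ) : eval (c • x) h = c ^ d * eval x h := by
  rw [eval_eq, eval_eq, Finset.mul_sum]
  refine Finset.sum_congr rfl fun u hu => ?_
  have hu' := hh.degree_eq_sum_deg_support hu
  simp only [Pi.smul_apply, smul_eq_mul, mul_pow, Finset.prod_mul_distrib,
    Finset.prod_pow_eq_pow_sum]
  rw [hu']
  ring

/-- The restriction of a polynomial to a line is a univariate polynomial. -/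
theorem exists_polynomial_eval_line {σ : Type*} (h : MvPolynomial σ ℝ) (x v : σ → ℝ) :
    ∃ U : Polynomial ℝ, ∀ t, U.eval t = eval (x + t • v) h := by
  refine ⟨aeval (fun i => Polynomial.C (x i) + Polynomial.X * Polynomial.C (v i)) h, fun t => ?_⟩
  have := MvPolynomial.map_aeval
    (fun i => Polynomial.C (x i) + Polynomial.X * Polynomial.C (v i)) (Polynomial.evalRingHom t) h
  rw [Polynomial.coe_evalRingHom] at this
  rw [this, MvPolynomial.coe_eval₂Hom]
  have h1 : (Polynomial.evalRingHom t).comp (algebraMap ℝ (Polynomial ℝ)) = RingHom.id ℝ := by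
    ext a; simp
  rw [h1]
  rw [eval, MvPolynomial.coe_eval₂Hom]
  congr 1
  ext i
  simp
  ring

/-- The elementary symmetric functions of the eigenvalues depend polynomially on the position
along a line. -/
theorem IsHyperbolic.exists_polynomial_esymm {m d : ℕ} {h : MvPolynomial (Fin m) ℝ}
    {e : Fin m → ℝ} {lam : (Fin m → ℝ) → Fin d → ℝ} (hh : IsHyperbolic h e lam)
    (v x : Fin m → ℝ) (k : ℕ) :
    ∃ P : Polynomial ℝ, ∀ s, P.eval s = eval (lam (v + s • x)) (esymm (Fin d) ℝ k) := by
  obtain ⟨-, hpos, -, hroots⟩ := hh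
  by_cases hk : k ≤ d
  swap
  · refine ⟨0, fun s => ?_⟩
    have := aeval_esymm_eq_multiset_esymm (Fin d) ℝ k (lam (v + s • x))
    rw [Multiset.esymm, Multiset.powersetCard_eq_empty] at this
    · simpa using this.symm
    · simpa using hk
  let Q : Polynomial (Polynomial ℝ) := aeval (fun i => Polynomial.X * Polynomial.C (Polynomial.C (e i))
    - Polynomial.C (Polynomial.C (v i) + Polynomial.X * Polynomial.C (x i))) h
  have hQ : ∀ s : ℝ, Q.map (Polynomial.evalRingHom s) =
      Polynomial.C (eval e h) * ∏ i, (Polynomial.X - Polynomial.C (lam (v + s • x) i)) := by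
    intro s
    refine Polynomial.funext fun t => ?_
    have h2 : Polynomial.eval t (Q.map (Polynomial.evalRingHom s)) =
        eval (t • e - (v + s • x)) h := by
      have := MvPolynomial.map_aeval (fun i => Polynomial.X * Polynomial.C (Polynomial.C (e i))
        - Polynomial.C (Polynomial.C (v i) + Polynomial.X * Polynomial.C (x i)))
        ((Polynomial.evalRingHom t).comp (Polynomial.mapRingHom (Polynomial.evalRingHom s))) h
      rw [RingHom.comp_apply, Polynomial.coe_evalRingHom, Polynomial.coe_mapRingHom] at this
      rw [this, MvPolynomial.coe_eval₂Hom, eval, MvPolynomial.coe_eval₂Hom]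
      have h1 : ((Polynomial.evalRingHom t).comp
          (Polynomial.mapRingHom (Polynomial.evalRingHom s))).comp
          (algebraMap ℝ (Polynomial (Polynomial ℝ))) = RingHom.id ℝ := by
        ext a; simp
      rw [h1]
      congr 1
      ext i
      simp
      ring
    rw [h2, hroots, Polynomial.eval_mul, Polynomial.eval_C, Polynomial.eval_prod]
    simp
  refine ⟨Polynomial.C ((-1) ^ k / eval e h) * Q.coeff (d - k), fun s => ?_⟩
  have h3 : (Q.coeff (d - k)).eval s = (Q.map (Polynomial.evalRingHom s)).coeff (d - k) := by
    simp
  have h4 := Multiset.prod_X_sub_C_coeff (Finset.univ.val.map (lam (v + s • x)))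
    (k := d - k) (by simp)
  rw [Multiset.map_map, ← aeval_esymm_eq_multiset_esymm (Fin d) ℝ] at h4
  simp only [Multiset.card_map, Finset.card_val, Finset.card_univ, Fintype.card_fin,
    Nat.sub_sub_self hk] at h4
  have h5 : (∏ i, (Polynomial.X - Polynomial.C (lam (v + s • x) i))).coeff (d - k) =
      (-1) ^ k * eval (lam (v + s • x)) (esymm (Fin d) ℝ k) := h4
  rw [Polynomial.eval_mul, Polynomial.eval_C, h3, hQ, Polynomial.coeff_C_mul, h5]
  have h6 : ((-1 : ℝ) ^ k) * (-1) ^ k = 1 := by rw [← mul_pow]; simp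
  field_simp
  linear_combination (eval (lam (v + s • x)) (esymm (Fin d) ℝ k)) * h6

/-- Symmetric functions of the eigenvalues depend polynomially on the position along a line. -/
theorem IsHyperbolic.exists_polynomial_of_isSymmetric {m d : ℕ} {h : MvPolynomial (Fin m) ℝ}
    {e : Fin m → ℝ} {lam : (Fin m → ℝ) → Fin d → ℝ} (hh : IsHyperbolic h e lam)
    (v x : Fin m → ℝ) {φ : MvPolynomial (Fin d) ℝ} (hφ : φ.IsSymmetric) :
    ∃ P : Polynomial ℝ, ∀ s, P.eval s = eval (lam (v + s • x)) φ := by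
  choose E hE using hh.exists_polynomial_esymm v x
  obtain ⟨ψ, hψ⟩ := esymmAlgHom_surjective (σ := Fin d) ℝ (n := d) (by simp) ⟨φ, hφ⟩
  have hψ' := esymmAlgHom_apply (σ := Fin d) (R := ℝ) ψ
  rw [hψ] at hψ'
  refine ⟨aeval (fun i : Fin d => E (i + 1)) ψ, fun s => ?_⟩
  have h1 : φ = aeval (fun i : Fin d => esymm (Fin d) ℝ (i + 1)) ψ := hψ'
  have h2 := MvPolynomial.comp_aeval_apply (fun i : Fin d => E (i + 1)) (Polynomial.aeval s) ψ
  have h3 := MvPolynomial.comp_aeval_apply (fun i : Fin d => esymm (Fin d) ℝ (i + 1))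
    (MvPolynomial.aeval (lam (v + s • x))) ψ
  rw [Polynomial.coe_aeval_eq_eval] at h2
  rw [h2, h1, ← MvPolynomial.coe_aeval_eq_eval]
  refine Eq.trans ?_ h3.symm
  congr 2
  ext i
  simp [hE]

/-- A nonnegative polynomial vanishing at `0` vanishes to second order there. -/
theorem Polynomial.exists_le_mul_sq_of_nonneg {P : Polynomial ℝ} (h0 : P.eval 0 = 0)
    (hP : ∀ s, 0 ≤ P.eval s) : ∃ K, 0 < K ∧ ∀ s, |s| ≤ 1 → P.eval s ≤ K * s ^ 2 := by
  have hd : P.derivative.eval 0 = 0 := by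
    rw [← Polynomial.deriv]
    refine IsLocalMin.deriv_eq_zero (Filter.Eventually.of_forall fun s => ?_)
    exact h0.trans_le (hP s)
  obtain ⟨Q, rfl⟩ := Polynomial.X_dvd_iff.2 ((Polynomial.coeff_zero_eq_eval_zero P).trans h0)
  have hQ : Q.eval 0 = 0 := by simpa using hd
  obtain ⟨R, rfl⟩ := Polynomial.X_dvd_iff.2 ((Polynomial.coeff_zero_eq_eval_zero Q).trans hQ)
  obtain ⟨K, hK⟩ := (isCompact_Icc (a := (-1 : ℝ)) (b := 1)).exists_bound_of_continuousOn
    R.continuous.continuousOn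
  refine ⟨|K| + 1, by positivity, fun s hs => ?_⟩
  have h1 := (abs_le.1 (hK s (abs_le.1 hs))).2
  have h2 := le_abs_self K
  simp only [Polynomial.eval_mul, Polynomial.eval_X]
  nlinarith [sq_nonneg s]

/-- A polynomial of at most linear growth is affine. -/
theorem Polynomial.natDegree_le_one_of_sq_le {U : Polynomial ℝ} {C : ℝ}
    (hU : ∀ᶠ t in Filter.atTop, (U.eval t) ^ 2 ≤ C * t ^ 2) : U.natDegree ≤ 1 := by
  by_contra! hdeg
  have h1 := Polynomial.abs_div_tendsto_atTop_atTop_of_degree_gt U Polynomial.X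
    (Polynomial.degree_lt_degree (by rwa [Polynomial.natDegree_X]))
    Polynomial.X_ne_zero
  have h2 := h1.eventually_gt_atTop (|C| + 1)
  obtain ⟨t, h3, h4, h5⟩ := (hU.and (h2.and (Filter.eventually_gt_atTop 0))).exists
  rw [Polynomial.eval_X, abs_div, abs_of_pos h5, lt_div_iff₀ h5] at h4
  have h6 : ((|C| + 1) * t) ^ 2 < (U.eval t) ^ 2 := by
    rw [← sq_abs (U.eval t)]
    exact pow_lt_pow_left₀ h4 (by positivity) two_ne_zero
  nlinarith [le_abs_self C, abs_nonneg C, sq_pos_of_pos h5, mul_nonneg (abs_nonneg C) (sq_nonneg t),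
    mul_nonneg (mul_nonneg (abs_nonneg C) (abs_nonneg C)) (sq_nonneg t),
    mul_nonneg (sub_nonneg.2 (le_abs_self C)) (sq_nonneg t)]

theorem mul_le_sq_sum_sub_sum_sq {ι : Type*} [Fintype ι] {a : ι → ℝ} (ha : ∀ i, 0 ≤ a i)
    {i j : ι} (hij : i ≠ j) : a i * a j ≤ (∑ k, a k) ^ 2 - ∑ k, a k ^ 2 := by
  have h1 : (∑ k, a k) ^ 2 - ∑ k, a k ^ 2 = ∑ k, a k * (∑ l, a l - a k) := by
    simp only [mul_sub, Finset.sum_sub_distrib, ← Finset.sum_mul, sq]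
  have h2 : ∀ k, 0 ≤ ∑ l, a l - a k := fun k =>
    sub_nonneg.2 (Finset.single_le_sum (fun l _ => ha l) (Finset.mem_univ k))
  have h3 : a j ≤ ∑ l, a l - a i := by
    have := Finset.sum_le_sum_of_subset_of_nonneg (Finset.subset_univ {i, j})
      (fun l _ _ => ha l)
    rw [Finset.sum_pair hij] at this
    linarith
  rw [h1]
  exact (mul_le_mul_of_nonneg_left h3 (ha i)).trans
    (Finset.single_le_sum (f := fun k => a k * (∑ l, a l - a k))
      (fun k _ => mul_nonneg (ha k) (h2 k)) (Finset.mem_univ i))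

theorem sq_sum_sub_sum_sq_nonneg {ι : Type*} [Fintype ι] {a : ι → ℝ} (ha : ∀ i, 0 ≤ a i) :
    0 ≤ (∑ k, a k) ^ 2 - ∑ k, a k ^ 2 := by
  have h1 : (∑ k, a k) ^ 2 - ∑ k, a k ^ 2 = ∑ k, a k * (∑ l, a l - a k) := by
    simp only [mul_sub, Finset.sum_sub_distrib, ← Finset.sum_mul, sq]
  rw [h1]
  exact Finset.sum_nonneg fun k _ => mul_nonneg (ha k)
    (sub_nonneg.2 (Finset.single_le_sum (fun l _ => ha l) (Finset.mem_univ k)))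

/-- If the sum of nonnegative numbers is bounded below and all pairwise products are small, then
all but one of the numbers are small. -/
theorem prod_le_of_pairwise_mul_le {d : ℕ} {a : Fin d → ℝ} {c M ε : ℝ} (ha : ∀ i, 0 ≤ a i)
    (hc : 0 < c) (hsum : c ≤ ∑ i, a i) (hM : ∑ i, a i ≤ M)
    (hpair : ∀ i j, i ≠ j → a i * a j ≤ ε) : ∏ i, a i ≤ M * (d / c * ε) ^ (d - 1) := by
  have hd : 0 < d := by
    rcases Nat.eq_zero_or_pos d with rfl | hd
    · simp at hsum; linarith
    · exact hd
  have hd' : (0 : ℝ) < d := by exact_mod_cast hd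
  obtain ⟨i, -, hi⟩ : ∃ i ∈ Finset.univ, c / d ≤ a i := by
    refine Finset.exists_le_of_sum_le ⟨⟨0, hd⟩, Finset.mem_univ _⟩ ?_
    simp only [Finset.sum_const, Finset.card_univ, Fintype.card_fin, nsmul_eq_mul]
    rwa [mul_div_cancel₀ _ hd'.ne']
  have hsmall : ∀ j ∈ Finset.univ.erase i, a j ≤ d / c * ε := by
    intro j hj
    have h1 := hpair i j (Finset.ne_of_mem_erase hj).symm
    have h2 : c / d * a j ≤ ε := (mul_le_mul_of_nonneg_right hi (ha j)).trans h1
    calc a j = d / c * (c / d * a j) := by field_simp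
      _ ≤ _ := by gcongr
  rw [← Finset.mul_prod_erase _ _ (Finset.mem_univ i)]
  have h3 := Finset.prod_le_prod (fun j _ => ha j) hsmall
  rw [Finset.prod_const, Finset.card_erase_of_mem (Finset.mem_univ i), Finset.card_univ,
    Fintype.card_fin] at h3
  have h4 := (Finset.single_le_sum (fun l _ => ha l) (Finset.mem_univ i)).trans hM
  exact mul_le_mul h4 h3 (Finset.prod_nonneg fun j _ => ha j) ((ha i).trans h4)

/-- Near a vector of hyperbolic rank at most one, the product of the squared eigenvalues vanishes
to order `2 (d - 1)`. -/
theorem IsHyperbolic.exists_prod_sq_le {m d : ℕ} {h : MvPolynomial (Fin m) ℝ}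
    {e : Fin m → ℝ} {lam : (Fin m → ℝ) → Fin d → ℝ} (hh : IsHyperbolic h e lam)
    {v : Fin m → ℝ} (hv : hrank lam v ≤ 1) (x : Fin m → ℝ) :
    ∃ C, ∀ᶠ s in nhds (0 : ℝ), ∏ i, lam (v + s • x) i ^ 2 ≤ C * (s ^ 2) ^ (d - 1) := by
  obtain ⟨P, hP⟩ := hh.exists_polynomial_of_isSymmetric v x (psum_isSymmetric (Fin d) ℝ 2)
  obtain ⟨R, hR⟩ := hh.exists_polynomial_of_isSymmetric v x (psum_isSymmetric (Fin d) ℝ 4)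
  simp only [psum, map_sum, map_pow, eval_X] at hP hR
  have hnn : ∀ (s : ℝ) (i : Fin d), 0 ≤ lam (v + s • x) i ^ 2 := fun s i => sq_nonneg _
  have hG : ∀ s, (P ^ 2 - R).eval s =
      (∑ i, lam (v + s • x) i ^ 2) ^ 2 - ∑ i, (lam (v + s • x) i ^ 2) ^ 2 := by
    intro s
    simp only [Polynomial.eval_sub, Polynomial.eval_pow, hP, hR, ← pow_mul]
  have hG0 : (P ^ 2 - R).eval 0 = 0 := by
    have h1 : ∀ i j, i ≠ j → lam v i ^ 2 * lam v j ^ 2 = 0 := by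
      intro i j hij
      by_contra hne
      rw [hrank, Finite.card_le_one_iff_subsingleton] at hv
      have hi : lam v i ≠ 0 := fun h0 => hne (by simp [h0])
      have hj : lam v j ≠ 0 := fun h0 => hne (by simp [h0])
      exact hij (congrArg Subtype.val (hv.elim ⟨i, hi⟩ ⟨j, hj⟩))
    rw [hG, zero_smul, add_zero, sq, Finset.sum_mul_sum, sub_eq_zero]
    refine Finset.sum_congr rfl fun i _ => ?_
    rw [Finset.sum_eq_single i (fun j _ hj => h1 i j hj.symm) (by simp), sq (lam v i ^ 2)]
  have hGnn : ∀ s, 0 ≤ (P ^ 2 - R).eval s := fun s => by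
    rw [hG]; exact sq_sum_sub_sum_sq_nonneg (hnn s)
  have hPnn : ∀ s, 0 ≤ P.eval s := fun s => by
    rw [hP]; exact Finset.sum_nonneg fun i _ => hnn s i
  have hnear : ∀ᶠ s in nhds (0 : ℝ), |s| ≤ 1 := by
    filter_upwards [Metric.closedBall_mem_nhds (0 : ℝ) one_pos] with s hs
    simpa using hs
  rcases (hPnn 0).eq_or_lt with h0 | h0
  · obtain ⟨K, hK, hPK⟩ := Polynomial.exists_le_mul_sq_of_nonneg h0.symm hPnn
    refine ⟨K ^ d, ?_⟩
    filter_upwards [hnear] with s hs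
    have h1 : ∀ i ∈ Finset.univ, lam (v + s • x) i ^ 2 ≤ K * s ^ 2 := fun i hi =>
      (Finset.single_le_sum (fun l _ => hnn s l) hi).trans ((hP s).symm.le.trans (hPK s hs))
    have h2 := Finset.prod_le_prod (fun i _ => hnn s i) h1
    rw [Finset.prod_const, Finset.card_univ, Fintype.card_fin, mul_pow] at h2
    refine h2.trans (mul_le_mul_of_nonneg_left ?_ (by positivity))
    exact pow_le_pow_of_le_one (sq_nonneg s) (by rwa [sq_le_one_iff_abs_le_one]) (Nat.sub_le d 1)
  · obtain ⟨K, hK, hGK⟩ := Polynomial.exists_le_mul_sq_of_nonneg hG0 hGnn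
    have hcont : Filter.Tendsto (fun s => P.eval s) (nhds 0) (nhds (P.eval 0)) :=
      P.continuous.tendsto 0
    refine ⟨(P.eval 0 + 1) * (d / (P.eval 0 / 2) * K) ^ (d - 1), ?_⟩
    filter_upwards [hnear, hcont.eventually_lt_const (lt_add_one (P.eval 0)),
      hcont.eventually_const_lt (half_lt_self h0)] with s hs hM hc
    rw [hP s] at hM hc
    refine (prod_le_of_pairwise_mul_le (hnn s) (half_pos h0) hc.le hM.le (ε := K * s ^ 2)
      fun i j hij => ?_).trans (le_of_eq ?_)
    · exact (mul_le_sq_sum_sub_sum_sq (hnn s) hij).trans ((hG s).symm.le.trans (hGK s hs))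
    · rw [← mul_assoc, mul_pow, mul_assoc]

/-- A hyperbolic polynomial is affine in every direction of hyperbolic rank at most one. -/
theorem IsHyperbolic.exists_eval_eq_affine {m d : ℕ} {h : MvPolynomial (Fin m) ℝ}
    {e : Fin m → ℝ} {lam : (Fin m → ℝ) → Fin d → ℝ} (hh : IsHyperbolic h e lam)
    {v : Fin m → ℝ} (hv : hrank lam v ≤ 1) (x : Fin m → ℝ) :
    ∃ a b : ℝ, ∀ t : ℝ, eval (x + t • v) h = a + b * t := by
  obtain ⟨C, hC⟩ := hh.exists_prod_sq_le hv x
  obtain ⟨U, hU⟩ := exists_polynomial_eval_line h x v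
  obtain ⟨hhom, hpos, -, hroots⟩ := hh
  have hsq : ∀ y, eval y h ^ 2 = eval e h ^ 2 * ∏ i, lam y i ^ 2 := by
    intro y
    have h1 := hroots y 0
    have h2 := hhom.eval_smul_eq (-1) y
    rw [zero_smul, zero_sub] at h1
    rw [neg_one_smul, h1] at h2
    have h3 : ((-1 : ℝ) ^ d) ^ 2 = 1 := by rw [← pow_mul, mul_comm, pow_mul]; simp
    have h4 : (∏ i, (0 - lam y i)) ^ 2 = ∏ i, lam y i ^ 2 := by
      rw [← Finset.prod_pow]; simp
    rw [← h4, ← mul_pow, h2, mul_pow, h3, one_mul]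
  have hdeg : U.natDegree ≤ 1 := by
    refine Polynomial.natDegree_le_one_of_sq_le (C := eval e h ^ 2 * |C|) ?_
    filter_upwards [tendsto_inv_atTop_zero.eventually hC, Filter.eventually_ge_atTop 1]
      with t ht ht1
    have ht0 : t ≠ 0 := by positivity
    have h1 : x + t • v = t • (v + t⁻¹ • x) := by
      rw [smul_add, smul_smul, mul_inv_cancel₀ ht0, one_smul, add_comm]
    rw [hU, h1, hhom.eval_smul_eq, mul_pow, hsq]
    have h2 : (t ^ d) ^ 2 * (t⁻¹ ^ 2) ^ (d - 1) ≤ t ^ 2 := by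
      rcases d with _ | k
      · rw [pow_zero, one_pow, Nat.zero_sub, pow_zero, one_mul]
        exact one_le_pow₀ ht1
      · rw [Nat.add_sub_cancel, ← pow_mul, ← pow_mul, inv_pow,
          show (k + 1) * 2 = 2 + 2 * k by ring, pow_add, mul_assoc,
          mul_inv_cancel₀ (pow_ne_zero _ ht0), mul_one]
    calc (t ^ d) ^ 2 * (eval e h ^ 2 * ∏ i, lam (v + t⁻¹ • x) i ^ 2)
        ≤ (t ^ d) ^ 2 * (eval e h ^ 2 * (|C| * (t⁻¹ ^ 2) ^ (d - 1))) := by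
          gcongr
          exact ht.trans (mul_le_mul_of_nonneg_right (le_abs_self C) (by positivity))
      _ = eval e h ^ 2 * |C| * ((t ^ d) ^ 2 * (t⁻¹ ^ 2) ^ (d - 1)) := by ring
      _ ≤ _ := by gcongr
  refine ⟨U.coeff 0, U.coeff 1, fun t => ?_⟩
  rw [← hU, Polynomial.eval_eq_sum_range' (n := 2) (by omega), Finset.sum_range_succ,
    Finset.sum_range_one, pow_zero, mul_one, pow_one]

/-- Two-term expectation identity: for a centered finite-support random variable `ξ`
with variance `τ²` and a hyperbolic-rank-one vector `v`,
`E[h(x₁ - ξ v) h(x₂ + ξ v)] = (1 - (1/2) d²/dt²)|₀ [h(x₁ + tτv) h(x₂ + tτv)]`. -/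
theorem two_term_expectation
    {m d : ℕ} (h : MvPolynomial (Fin m) ℝ) (e : Fin m → ℝ)
    (lam : (Fin m → ℝ) → Fin d → ℝ)
    (hhyp : IsHyperbolic h e lam)
    (S : Finset ℝ) (p : ℝ → ℝ)
    (hS : S.Nonempty)
    (hp : ∀ a ∈ S, 0 < p a)
    (hp1 : ∑ a ∈ S, p a = 1)
    (hmean : ∑ a ∈ S, p a * a = 0)
    (τ : ℝ) (hτ : τ ^ 2 = ∑ a ∈ S, p a * a ^ 2)
    (v : Fin m → ℝ) (hvrank : hrank lam v ≤ 1)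
    (x₁ x₂ : Fin m → ℝ) :
    ∑ a ∈ S, p a * (eval (x₁ - a • v) h * eval (x₂ + a • v) h)
      = (fun t : ℝ => eval (x₁ + (t * τ) • v) h * eval (x₂ + (t * τ) • v) h) 0
        - (1 / 2) *
          deriv (deriv
            (fun t : ℝ => eval (x₁ + (t * τ) • v) h * eval (x₂ + (t * τ) • v) h)) 0 := by
  obtain ⟨a₁, b₁, h₁⟩ := hhyp.exists_eval_eq_affine hvrank x₁
  obtain ⟨a₂, b₂, h₂⟩ := hhyp.exists_eval_eq_affine hvrank x₂
  have h₁' : ∀ a : ℝ, eval (x₁ - a • v) h = a₁ - b₁ * a := fun a => by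
    rw [sub_eq_add_neg, ← neg_smul, h₁]; ring
  simp only [h₁, h₁', h₂]
  have hd1 : deriv (fun t : ℝ => (a₁ + b₁ * (t * τ)) * (a₂ + b₂ * (t * τ))) =
      fun t => (a₁ * b₂ + a₂ * b₁) * τ + 2 * b₁ * b₂ * τ ^ 2 * t := by
    ext t
    have hf : ∀ a b : ℝ, HasDerivAt (fun t : ℝ => a + b * (t * τ)) (b * (1 * τ)) t := fun a b =>
      (((hasDerivAt_id t).mul_const τ).const_mul b).const_add a
    rw [((hf a₁ b₁).fun_mul (hf a₂ b₂)).deriv]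
    ring
  have hd2 : deriv (fun t : ℝ => (a₁ * b₂ + a₂ * b₁) * τ + 2 * b₁ * b₂ * τ ^ 2 * t) 0 =
      2 * b₁ * b₂ * τ ^ 2 := by
    have hf := ((hasDerivAt_id' (0 : ℝ)).const_mul (2 * b₁ * b₂ * τ ^ 2)).const_add
      ((a₁ * b₂ + a₂ * b₁) * τ)
    rw [hf.deriv, mul_one]
  have hsum : ∑ a ∈ S, p a * ((a₁ - b₁ * a) * (a₂ + b₂ * a)) =
      a₁ * a₂ * ∑ a ∈ S, p a + (a₁ * b₂ - b₁ * a₂) * ∑ a ∈ S, p a * a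
        - b₁ * b₂ * ∑ a ∈ S, p a * a ^ 2 := by
    rw [Finset.mul_sum, Finset.mul_sum, Finset.mul_sum, ← Finset.sum_add_distrib,
      ← Finset.sum_sub_distrib]
    exact Finset.sum_congr rfl fun a _ => by ring
  rw [hd1, hd2, hsum, hp1, hmean, ← hτ]
  ring
end
end
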